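/- arXiv:1907.05631 — 9 statements merged into one kernel-verified Lean document; each statement's English description precedes it below -/
import Mathlib

section
/- Let ε ∈ (0, 1/2), let m ≥ 2 be an integer, and let f : ℝ → ℝ be measurable with f ∈ L¹(ℝ) and ∫_ℝ∫_ℝ |f(u)f(v)| |u−v|^{2ε−1} du dv < ∞. Then the m-fold cyclic integral ∫_{ℝ^m} f(u₁)⋯f(u_m) |u₁−u₂|^{H−1} |u₂−u₃|^{H−1} ⋯ |u_{m−1}−u_m|^{H−1} |u_m−u₁|^{H−1} du₁⋯du_m converges, as H → 1 from the left (H ∈ (1/2+ε, 1)), to (∫_ℝ f(u) du)^m. -/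
open MeasureTheory ENNReal Set Filter

/-- The product of a kernel along the consecutive pairs of a tuple. -/
noncomputable def chainProd {α : Type*} (K : α → α → ℝ≥0∞) {n : ℕ} (u : Fin (n + 1) → α) : ℝ≥0∞ :=
  ∏ i : Fin n, K (u i.castSucc) (u i.succ)

theorem chainProd_cons_cons {α : Type*} (K : α → α → ℝ≥0∞) {n : ℕ} (a z : α) (w : Fin n → α) :
    chainProd K (Fin.cons a (Fin.cons z w) : Fin (n + 2) → α) =
      K a z * chainProd K (Fin.cons z w : Fin (n + 1) → α) := by
  simp [chainProd, Fin.prod_univ_succ (n := n)]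

section CyclicKernel

variable {α : Type*} [MeasurableSpace α] {μ : Measure α}

theorem lintegral_pi_fin_succ [SigmaFinite μ] {n : ℕ} {F : (Fin (n + 1) → α) → ℝ≥0∞}
    (hF : Measurable F) :
    ∫⁻ u, F u ∂Measure.pi (fun _ ↦ μ) =
      ∫⁻ a, ∫⁻ v, F (Fin.cons a v) ∂Measure.pi (fun _ : Fin n ↦ μ) ∂μ := by
  have h := (measurePreserving_piFinSuccAbove (fun _ : Fin (n + 1) ↦ μ) 0).symm
  rw [← h.lintegral_comp hF,
    lintegral_prod (fun p ↦ F _) (hF.comp (MeasurableEquiv.measurable _)).aemeasurable]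
  simp [MeasurableEquiv.piFinSuccAbove, Fin.insertNthEquiv]

theorem measurable_chainProd {K : α → α → ℝ≥0∞} (hK : Measurable (Function.uncurry K)) {n : ℕ} :
    Measurable (chainProd K : (Fin (n + 1) → α) → ℝ≥0∞) :=
  Finset.measurable_fun_prod _ fun i _ ↦
    show Measurable fun u : Fin (n + 1) → α ↦ Function.uncurry K (u i.castSucc, u i.succ) from
      hK.comp ((measurable_pi_apply i.castSucc).prodMk (measurable_pi_apply i.succ))

theorem lintegral_mul_le_sqrt_mul_sqrt {g h : α → ℝ≥0∞} (hg : Measurable g) (hh : Measurable h) :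
    ∫⁻ a, g a * h a ∂μ ≤
      (∫⁻ a, g a ^ (2 : ℝ) ∂μ) ^ (1 / 2 : ℝ) * (∫⁻ a, h a ^ (2 : ℝ) ∂μ) ^ (1 / 2 : ℝ) :=
  ENNReal.lintegral_mul_le_Lp_mul_Lq μ Real.HolderConjugate.two_two hg.aemeasurable hh.aemeasurable

theorem lintegral_chainProd_cons [SigmaFinite μ] {K : α → α → ℝ≥0∞}
    (hK : Measurable (Function.uncurry K)) {g : α → ℝ≥0∞} (hg : Measurable g) (n : ℕ) (a : α) :
    ∫⁻ v, chainProd K (Fin.cons a v : Fin (n + 2) → α) *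
        g ((Fin.cons a v : Fin (n + 2) → α) (Fin.last _)) ∂Measure.pi (fun _ ↦ μ) =
      ∫⁻ z, K a z * ∫⁻ w, chainProd K (Fin.cons z w : Fin (n + 1) → α) *
        g ((Fin.cons z w : Fin (n + 1) → α) (Fin.last _)) ∂Measure.pi (fun _ ↦ μ) ∂μ := by
  have hcons (k : ℕ) (b : α) : Measurable fun v : Fin k → α ↦ (Fin.cons b v : Fin (k + 1) → α) :=
    measurable_pi_iff.2 (Fin.cases (by simp) fun i ↦ by simpa using measurable_pi_apply i)
  have hm (k : ℕ) (b : α) : Measurable fun v : Fin k → α ↦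
      chainProd K (Fin.cons b v : Fin (k + 1) → α) *
        g ((Fin.cons b v : Fin (k + 1) → α) (Fin.last _)) :=
    ((measurable_chainProd hK).mul (hg.comp (measurable_pi_apply _))).comp (hcons k b)
  rw [lintegral_pi_fin_succ (hm _ a)]
  refine lintegral_congr fun z ↦ ?_
  rw [← lintegral_const_mul _ (hm n z)]
  refine lintegral_congr fun w ↦ ?_
  rw [chainProd_cons_cons, mul_assoc, ← Fin.succ_last, Fin.cons_succ]

theorem lintegral_chainProd_le [SigmaFinite μ] {K : α → α → ℝ≥0∞}
    (hK : Measurable (Function.uncurry K)) {g : α → ℝ≥0∞} (hg : Measurable g) (n : ℕ) (a : α) :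
    ∫⁻ v, chainProd K (Fin.cons a v : Fin (n + 2) → α) *
        g ((Fin.cons a v : Fin (n + 2) → α) (Fin.last _)) ∂Measure.pi (fun _ ↦ μ) ≤
      (∫⁻ y, K a y ^ (2 : ℝ) ∂μ) ^ (1 / 2 : ℝ) *
        (((∫⁻ x, ∫⁻ y, K x y ^ (2 : ℝ) ∂μ ∂μ) ^ (1 / 2 : ℝ)) ^ n *
          (∫⁻ y, g y ^ (2 : ℝ) ∂μ) ^ (1 / 2 : ℝ)) := by
  have hKa (a : α) : Measurable (K a) := hK.of_uncurry_left
  induction n generalizing a with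
  | zero =>
    rw [lintegral_chainProd_cons hK hg]
    simpa [chainProd] using lintegral_mul_le_sqrt_mul_sqrt (hKa a) hg
  | succ n ih =>
    rw [lintegral_chainProd_cons hK hg]
    have hG : Measurable fun z ↦ (∫⁻ y, K z y ^ (2 : ℝ) ∂μ) ^ (1 / 2 : ℝ) :=
      (Measurable.lintegral_prod_right (hK.pow_const _)).pow_const _
    calc
      _ ≤ ∫⁻ z, (K a z * (∫⁻ y, K z y ^ (2 : ℝ) ∂μ) ^ (1 / 2 : ℝ)) *
          (((∫⁻ x, ∫⁻ y, K x y ^ (2 : ℝ) ∂μ ∂μ) ^ (1 / 2 : ℝ)) ^ n *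
            (∫⁻ y, g y ^ (2 : ℝ) ∂μ) ^ (1 / 2 : ℝ)) ∂μ :=
        lintegral_mono fun z ↦ by rw [mul_assoc]; gcongr; exact ih z
      _ = (∫⁻ z, K a z * (∫⁻ y, K z y ^ (2 : ℝ) ∂μ) ^ (1 / 2 : ℝ) ∂μ) *
          (((∫⁻ x, ∫⁻ y, K x y ^ (2 : ℝ) ∂μ ∂μ) ^ (1 / 2 : ℝ)) ^ n *
            (∫⁻ y, g y ^ (2 : ℝ) ∂μ) ^ (1 / 2 : ℝ)) :=
        lintegral_mul_const _ ((hKa a).mul hG)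
      _ ≤ _ := by
        grw [lintegral_mul_le_sqrt_mul_sqrt (hKa a) hG]
        simp only [← ENNReal.rpow_mul, one_div, inv_mul_cancel₀ (two_ne_zero' ℝ), ENNReal.rpow_one]
        rw [pow_succ']
        simp only [mul_assoc, le_refl]

/-- The cyclic integral of a symmetric Hilbert–Schmidt kernel is finite. -/
theorem lintegral_cyclic_prod_lt_top [SigmaFinite μ] {K : α → α → ℝ≥0∞}
    (hK : Measurable (Function.uncurry K)) (hsymm : ∀ x y, K x y = K y x)
    (hK2 : ∫⁻ x, ∫⁻ y, K x y ^ (2 : ℝ) ∂μ ∂μ < ⊤) (m : ℕ) [NeZero m] (hm : 2 ≤ m) :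
    ∫⁻ u : Fin m → α, ∏ i, K (u i) (u (i + 1)) ∂Measure.pi (fun _ ↦ μ) < ⊤ := by
  obtain ⟨n, rfl⟩ := Nat.exists_eq_add_of_le' hm
  have hprod (u : Fin (n + 2) → α) :
      ∏ i, K (u i) (u (i + 1)) = chainProd K u * K (u 0) (u (Fin.last _)) := by
    rw [Fin.prod_univ_castSucc, chainProd, hsymm (u 0)]
    simp [Fin.coeSucc_eq_succ]
  have hmeas : Measurable fun u : Fin (n + 2) → α ↦ chainProd K u * K (u 0) (u (Fin.last _)) :=
    (measurable_chainProd hK).mul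
      (show Measurable fun u : Fin (n + 2) → α ↦ Function.uncurry K (u 0, u (Fin.last _)) from
        hK.comp ((measurable_pi_apply 0).prodMk (measurable_pi_apply (Fin.last _))))
  simp_rw [hprod]
  rw [lintegral_pi_fin_succ hmeas]
  simp_rw [Fin.cons_zero]
  have hG : Measurable fun z ↦ ∫⁻ y, K z y ^ (2 : ℝ) ∂μ :=
    Measurable.lintegral_prod_right (hK.pow_const _)
  calc
    _ ≤ ∫⁻ a, ((∫⁻ x, ∫⁻ y, K x y ^ (2 : ℝ) ∂μ ∂μ) ^ (1 / 2 : ℝ)) ^ n *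
          ∫⁻ y, K a y ^ (2 : ℝ) ∂μ ∂μ := by
      refine lintegral_mono fun a ↦
        (lintegral_chainProd_le hK hK.of_uncurry_left n a).trans_eq ?_
      rw [mul_left_comm, ← ENNReal.rpow_add_of_nonneg _ _ (by norm_num) (by norm_num)]
      norm_num
    _ = ((∫⁻ x, ∫⁻ y, K x y ^ (2 : ℝ) ∂μ ∂μ) ^ (1 / 2 : ℝ)) ^ n *
          ∫⁻ x, ∫⁻ y, K x y ^ (2 : ℝ) ∂μ ∂μ := lintegral_const_mul _ hG
    _ < ⊤ := ENNReal.mul_lt_top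
      (ENNReal.pow_lt_top (ENNReal.rpow_lt_top_of_nonneg (by norm_num) hK2.ne)) hK2

end CyclicKernel

theorem volume_setOf_apply_eq_apply {ι : Type*} [Fintype ι] {i j : ι} (hij : i ≠ j) :
    volume {u : ι → ℝ | u i = u j} = 0 := by
  classical
  have h := Measure.addHaar_submodule (volume : Measure (ι → ℝ))
    (LinearMap.ker (LinearMap.proj (R := ℝ) (φ := fun _ : ι ↦ ℝ) i - LinearMap.proj j)) ?_
  · convert h using 2
    ext u
    simp [sub_eq_zero]
  · intro htop
    have := LinearMap.ker_eq_top.1 htop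
    simpa [hij.symm] using LinearMap.congr_fun this (Pi.single i 1)

theorem abs_rpow_le_one_add_abs_rpow {a b : ℝ} (hab : a ≤ b) (hb : b < 0) (t : ℝ) :
    |t| ^ b ≤ 1 + |t| ^ a := by
  rcases eq_or_ne t 0 with rfl | ht
  · simp [Real.zero_rpow hb.ne, Real.zero_rpow (hab.trans_lt hb).ne]
  have ht' : 0 < |t| := abs_pos.2 ht
  rcases le_total 1 |t| with h | h
  · exact (Real.rpow_le_one_of_one_le_of_nonpos h hb.le).trans (by simp; positivity)
  · exact (Real.rpow_le_rpow_of_exponent_ge ht' h hab).trans (by simp)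

/-- A kernel whose cyclic products dominate the integrands, uniformly in `H`. -/
noncomputable def dominatingKernel (ε : ℝ) (f : ℝ → ℝ) (x y : ℝ) : ℝ :=
  √|f x| * √|f y| * (1 + |x - y| ^ (ε - 1 / 2))

theorem measurable_dominatingKernel (ε : ℝ) {f : ℝ → ℝ} (hf : Measurable f) :
    Measurable (Function.uncurry (dominatingKernel ε f)) := by
  unfold dominatingKernel Function.uncurry
  fun_prop

theorem dominatingKernel_nonneg (ε : ℝ) (f : ℝ → ℝ) (x y : ℝ) : 0 ≤ dominatingKernel ε f x y := by
  unfold dominatingKernel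
  positivity

theorem dominatingKernel_comm (ε : ℝ) (f : ℝ → ℝ) (x y : ℝ) :
    dominatingKernel ε f x y = dominatingKernel ε f y x := by
  rw [dominatingKernel, dominatingKernel, abs_sub_comm, mul_comm √|f x|]

theorem dominatingKernel_sq_le (ε : ℝ) (f : ℝ → ℝ) (x y : ℝ) :
    dominatingKernel ε f x y ^ 2 ≤
      2 * (|f x * f y| + |f x * f y| * |x - y| ^ (2 * ε - 1)) := by
  have ht : (|x - y| ^ (ε - 1 / 2)) ^ 2 = |x - y| ^ (2 * ε - 1) := by
    rw [← Real.rpow_mul_natCast (abs_nonneg _)]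
    congr 1
    push_cast
    ring
  rw [dominatingKernel, mul_pow, mul_pow, Real.sq_sqrt (abs_nonneg _), Real.sq_sqrt (abs_nonneg _),
    ← ht, ← abs_mul]
  nlinarith [mul_nonneg (abs_nonneg (f x * f y)) (sq_nonneg (1 - |x - y| ^ (ε - 1 / 2)))]

theorem lintegral_dominatingKernel_sq_lt_top (ε : ℝ) {f : ℝ → ℝ} (hf : Measurable f)
    (hf1 : Integrable f)
    (hf2 : (∫⁻ p : ℝ × ℝ,
        ENNReal.ofReal (|f p.1 * f p.2| * |p.1 - p.2| ^ (2 * ε - 1))) < ⊤) :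
    ∫⁻ x, ∫⁻ y, ENNReal.ofReal (dominatingKernel ε f x y) ^ (2 : ℝ) < ⊤ := by
  have hmeas := ((measurable_dominatingKernel ε hf).ennreal_ofReal.pow_const (2 : ℝ))
  have h1 : ∫⁻ p : ℝ × ℝ, ENNReal.ofReal |f p.1 * f p.2| < ⊤ := by
    simpa [hasFiniteIntegral_iff_norm, Measure.volume_eq_prod] using (hf1.mul_prod hf1).2
  have hm1 : Measurable fun p : ℝ × ℝ ↦ ENNReal.ofReal |f p.1 * f p.2| := by fun_prop
  have h := lintegral_prod (μ := (volume : Measure ℝ)) (ν := (volume : Measure ℝ)) _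
    hmeas.aemeasurable
  simp only [Function.uncurry_apply_pair] at h
  rw [← h, ← Measure.volume_eq_prod]
  calc
    _ ≤ ∫⁻ p : ℝ × ℝ, 2 * (ENNReal.ofReal |f p.1 * f p.2| +
          ENNReal.ofReal (|f p.1 * f p.2| * |p.1 - p.2| ^ (2 * ε - 1))) := by
      refine lintegral_mono fun p ↦ ?_
      simp only [Function.uncurry]
      rw [ENNReal.rpow_two, ← ENNReal.ofReal_pow (dominatingKernel_nonneg ..),
        ← ENNReal.ofReal_add (by positivity) (by positivity),
        ← ENNReal.ofReal_ofNat, ← ENNReal.ofReal_mul (by norm_num)]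
      exact ENNReal.ofReal_le_ofReal (dominatingKernel_sq_le ..)
    _ < ⊤ := by
      rw [lintegral_const_mul' _ _ (by simp), lintegral_add_left hm1]
      exact ENNReal.mul_lt_top (by simp) (ENNReal.add_lt_top.2 ⟨h1, hf2⟩)

theorem integrable_prod_dominatingKernel (ε : ℝ) {f : ℝ → ℝ} (hf : Measurable f)
    (hf1 : Integrable f)
    (hf2 : (∫⁻ p : ℝ × ℝ,
        ENNReal.ofReal (|f p.1 * f p.2| * |p.1 - p.2| ^ (2 * ε - 1))) < ⊤)
    (m : ℕ) [NeZero m] (hm : 2 ≤ m) :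
    Integrable fun u : Fin m → ℝ ↦ ∏ i, dominatingKernel ε f (u i) (u (i + 1)) := by
  have hmeas := measurable_dominatingKernel ε hf
  refine ⟨(Finset.measurable_fun_prod _ fun i _ ↦ hmeas.comp
    ((measurable_pi_apply i).prodMk (measurable_pi_apply (i + 1)))).aestronglyMeasurable, ?_⟩
  rw [hasFiniteIntegral_iff_ofReal
    (.of_forall fun u ↦ Finset.prod_nonneg fun i _ ↦ dominatingKernel_nonneg ..)]
  simp_rw [ENNReal.ofReal_prod_of_nonneg fun i _ ↦ dominatingKernel_nonneg ..]
  exact lintegral_cyclic_prod_lt_top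
    (K := fun x y ↦ ENNReal.ofReal (dominatingKernel ε f x y)) hmeas.ennreal_ofReal
    (fun x y ↦ by rw [dominatingKernel_comm])
    (lintegral_dominatingKernel_sq_lt_top ε hf hf1 hf2) m hm

theorem prod_dominatingKernel (ε : ℝ) (f : ℝ → ℝ) {m : ℕ} [NeZero m] (u : Fin m → ℝ) :
    ∏ i, dominatingKernel ε f (u i) (u (i + 1)) =
      (∏ i, |f (u i)|) * ∏ i, (1 + |u i - u (i + 1)| ^ (ε - 1 / 2)) := by
  have hshift : ∏ i, √|f (u (i + 1))| = ∏ i, √|f (u i)| :=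
    Equiv.prod_comp (Equiv.addRight (1 : Fin m)) fun i ↦ √|f (u i)|
  simp only [dominatingKernel, Finset.prod_mul_distrib, hshift]
  simp only [← Finset.prod_mul_distrib, Real.mul_self_sqrt (abs_nonneg _)]


/-- For `ε ∈ (0, 1/2)`, `m ≥ 2`, and measurable `f : ℝ → ℝ` with `f ∈ L¹(ℝ)` and
`∫∫ |f(u)f(v)| |u−v|^{2ε−1} du dv < ∞`, the `m`-fold cyclic integral
`∫_{ℝ^m} f(u₁)⋯f(u_m) ∏ |u_i − u_{i+1}|^{H−1} du` (cyclically) converges, as `H → 1` from the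
left with `H ∈ (1/2 + ε, 1)`, to `(∫ f)^m`. -/
theorem cyclic_cumulant_integral_tendsto_of_H_to_one
    (ε : ℝ) (hε : ε ∈ Set.Ioo (0 : ℝ) (1 / 2))
    (m : ℕ) [NeZero m] (hm : 2 ≤ m)
    (f : ℝ → ℝ) (hf : Measurable f) (hf1 : Integrable f)
    (hf2 : (∫⁻ p : ℝ × ℝ,
        ENNReal.ofReal (|f p.1 * f p.2| * |p.1 - p.2| ^ (2 * ε - 1))) < ⊤) :
    Filter.Tendsto
      (fun H : ℝ =>
        ∫ u : Fin m → ℝ,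
          (∏ i : Fin m, f (u i)) * ∏ i : Fin m, |u i - u (i + 1)| ^ (H - 1))
      (nhdsWithin 1 (Set.Ioo (1 / 2 + ε) 1))
      (nhds ((∫ u : ℝ, f u) ^ m)) := by
  have hlt : ∀ᶠ H in nhdsWithin 1 (Set.Ioo (1 / 2 + ε) 1), H ∈ Set.Ioo (1 / 2 + ε) 1 :=
    self_mem_nhdsWithin
  have hpow : (∫ u : ℝ, f u) ^ m = ∫ u : Fin m → ℝ, ∏ i, f (u i) := by
    simp [integral_fintype_prod_volume_eq_pow f]
  rw [hpow]
  refine tendsto_integral_filter_of_dominated_convergence _ (.of_forall fun H ↦ ?_) ?_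
    (integrable_prod_dominatingKernel ε hf hf1 hf2 m hm) ?_
  · refine Measurable.aestronglyMeasurable ?_
    fun_prop
  · filter_upwards [hlt] with H hH
    refine .of_forall fun u ↦ ?_
    rw [prod_dominatingKernel, norm_mul, norm_prod, norm_prod]
    simp only [Real.norm_eq_abs]
    gcongr with i
    rw [abs_of_nonneg (by positivity)]
    exact abs_rpow_le_one_add_abs_rpow (by linarith [hH.1]) (by linarith [hH.2]) _
  · have hne : ∀ᵐ u : Fin m → ℝ, ∀ i, u i ≠ u (i + 1) := by
      refine ae_all_iff.2 fun i ↦ ?_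
      have hi : i ≠ i + 1 := by simp [show m ≠ 1 by omega]
      simpa [ae_iff] using volume_setOf_apply_eq_apply hi
    filter_upwards [hne] with u hu
    suffices h : Tendsto (fun H : ℝ ↦ (∏ i, f (u i)) * ∏ i, |u i - u (i + 1)| ^ (H - 1))
        (nhds 1) (nhds ((∏ i, f (u i)) * ∏ i, |u i - u (i + 1)| ^ ((1 : ℝ) - 1))) by
      simpa using h.mono_left nhdsWithin_le_nhds
    refine (tendsto_finsetProd _ fun i _ ↦ ?_).const_mul _
    exact tendsto_const_nhds.rpow ((continuous_id.sub continuous_const).tendsto 1)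
      (.inl (abs_pos.2 (sub_ne_zero.2 (hu i))).ne')
end

section
/- Let T > 0. The function H ↦ ∫_{[0,T]⁴} |u₁−u₂|^{H−1} |u₂−u₃|^{H−1} |u₃−u₄|^{H−1} |u₄−u₁|^{H−1} du₁ du₂ du₃ du₄ is finite for every H ∈ (1/4, 1] and is continuous on (1/4, 1]. -/
open MeasureTheory ENNReal Set

lemma integrableOn_abs_rpow_Icc {s : ℝ} (hs : -1 < s) {T : ℝ} (hT : 0 ≤ T) :
    IntegrableOn (fun x : ℝ => |x| ^ s) (Icc (-T) T) := by
  have pos : IntervalIntegrable (fun x : ℝ => |x| ^ s) volume 0 T :=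
    (intervalIntegral.intervalIntegrable_rpow' (a := 0) (b := T) hs).congr fun x hx => by
      rw [uIoc_of_le hT] at hx
      simp only [abs_of_pos hx.1]
  have neg : IntervalIntegrable (fun x : ℝ => |x| ^ s) volume (-T) 0 := by
    simpa using ((IntervalIntegrable.iff_comp_neg).1 pos).symm
  rw [← intervalIntegrable_iff_integrableOn_Icc_of_le (by linarith)]
  exact neg.trans pos

lemma MeasureTheory.Integrable.comp_injective_linearMap {ι : Type*} [Fintype ι]
    {F : (ι → ℝ) → ℝ} (hF : Integrable F) (L : (ι → ℝ) →ₗ[ℝ] (ι → ℝ))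
    (hL : Function.Injective L) : Integrable (fun u => F (L u)) := by
  have hdet : LinearMap.det L ≠ 0 :=
    (LinearEquiv.isUnit_det' (LinearEquiv.ofInjectiveEndo L hL)).ne_zero
  refine Integrable.comp_measurable (f := L) (g := F) ?_
    (LinearMap.continuous_of_finiteDimensional L).measurable
  rw [Measure.map_linearMap_addHaar_eq_smul_addHaar _ hdet]
  exact hF.smul_measure ENNReal.ofReal_ne_top

/-- Deleting one edge of the four-cycle leaves a path, along which the integral factorizes. -/
lemma integrableOn_prod_erase_abs_sub_rpow {s : ℝ} (hs : -1 < s) {T : ℝ} (hT : 0 ≤ T)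
    (j : Fin 4) :
    IntegrableOn (fun u : Fin 4 → ℝ => ∏ i ∈ Finset.univ.erase j, |u i - u (i + 1)| ^ s)
      (Set.pi univ fun _ => Icc 0 T) := by
  let L : (Fin 4 → ℝ) →ₗ[ℝ] (Fin 4 → ℝ) :=
    let p : Fin 4 → (Fin 4 → ℝ) →ₗ[ℝ] ℝ := LinearMap.proj
    LinearMap.pi fun i => if i = j then p j else p i - p (i + 1)
  have hLj : ∀ u, L u j = u j := fun u => by simp [L]
  have hLi : ∀ u i, i ≠ j → L u i = u i - u (i + 1) := fun u i hi => by simp [L, hi]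
  have hL : Function.Injective L := by
    rw [injective_iff_map_eq_zero]
    intro u hu
    have h0 : u j = 0 := by rw [← hLj u, hu]; rfl
    have h1 : ∀ i, i ≠ j → u i = u (i + 1) := fun i hi => by
      rw [← sub_eq_zero, ← hLi u i hi, hu]; rfl
    have e0 := h1 0
    have e1 := h1 1
    have e2 := h1 2
    have e3 := h1 3
    ext i
    fin_cases j <;> fin_cases i <;> simp_all
  let h : Fin 4 → ℝ → ℝ := fun i =>
    if i = j then (Icc 0 T).indicator 1 else (Icc (-T) T).indicator fun x => |x| ^ s
  have hh : ∀ i, Integrable (h i) := by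
    intro i
    by_cases hi : i = j
    · simp only [h, hi, if_true]
      exact (integrable_indicator_iff measurableSet_Icc).2 (integrableOn_const (by simp))
    · simp only [h, hi, if_false]
      exact (integrable_indicator_iff measurableSet_Icc).2 (integrableOn_abs_rpow_Icc hs hT)
  have hint := (Integrable.fintype_prod hh).comp_injective_linearMap L hL
  refine hint.integrableOn.congr_fun (fun u hu => ?_)
    (MeasurableSet.univ_pi fun _ => measurableSet_Icc)
  have hu' : ∀ i, u i ∈ Icc 0 T := fun i => hu i (mem_univ i)
  beta_reduce
  rw [← Finset.mul_prod_erase Finset.univ _ (Finset.mem_univ j)]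
  simp only [hLj, h, if_true, indicator_of_mem (hu' j), Pi.one_apply, one_mul]
  refine Finset.prod_congr rfl fun i hi => ?_
  have hi' := Finset.ne_of_mem_erase hi
  have hmem : u i - u (i + 1) ∈ Icc (-T) T := by
    have a := hu' i
    have b := hu' (i + 1)
    constructor <;> linarith [a.1, a.2, b.1, b.2]
  simp only [hi', if_false, hLi u i hi', indicator_of_mem hmem]

/-- Bound the smallest of four factors by the geometric mean of the others. -/
lemma prod_le_sum_prod_erase_rpow {f : Fin 4 → ℝ} (hf : ∀ i, 0 ≤ f i) :
    ∏ i, f i ≤ ∑ j, ∏ i ∈ Finset.univ.erase j, f i ^ (4 / 3 : ℝ) := by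
  obtain ⟨j, hj⟩ := Finite.exists_min f
  have hcube : f j = ∏ _i ∈ Finset.univ.erase j, f j ^ (1 / 3 : ℝ) := by
    rw [Finset.prod_const, Finset.card_erase_of_mem (Finset.mem_univ j), ← Real.rpow_natCast,
      ← Real.rpow_mul (hf j)]
    norm_num
  calc ∏ i, f i = f j * ∏ i ∈ Finset.univ.erase j, f i :=
        (Finset.mul_prod_erase _ _ (Finset.mem_univ j)).symm
    _ ≤ (∏ i ∈ Finset.univ.erase j, f i ^ (1 / 3 : ℝ)) * ∏ i ∈ Finset.univ.erase j, f i := by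
        refine mul_le_mul_of_nonneg_right ?_ (Finset.prod_nonneg fun i _ => hf i)
        rw [hcube]
        exact Finset.prod_le_prod (fun _ _ => Real.rpow_nonneg (hf j) _)
          fun i _ => Real.rpow_le_rpow (hf j) (hj i) (by norm_num)
    _ = ∏ i ∈ Finset.univ.erase j, f i ^ (4 / 3 : ℝ) := by
        rw [← Finset.prod_mul_distrib]
        refine Finset.prod_congr rfl fun i _ => ?_
        rw [← Real.rpow_add_one' (hf i) (by norm_num)]
        norm_num
    _ ≤ _ := Finset.single_le_sum
        (f := fun j => ∏ i ∈ Finset.univ.erase j, f i ^ (4 / 3 : ℝ))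
        (fun j _ => Finset.prod_nonneg fun i _ => Real.rpow_nonneg (hf i) _) (Finset.mem_univ j)

lemma measurable_prod_abs_sub_rpow (s : ℝ) :
    Measurable fun u : Fin 4 → ℝ => ∏ i, |u i - u (i + 1)| ^ s := by
  refine Finset.measurable_fun_prod _ fun i _ => ?_
  have : Measurable fun u : Fin 4 → ℝ => |u i - u (i + 1)| := by fun_prop
  exact this.pow_const s

lemma integrableOn_prod_abs_sub_rpow {H : ℝ} (hH : 1 / 4 < H) {T : ℝ} (hT : 0 ≤ T) :
    IntegrableOn (fun u : Fin 4 → ℝ => ∏ i, |u i - u (i + 1)| ^ (H - 1))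
      (Set.pi univ fun _ => Icc 0 T) := by
  have hs : -1 < (H - 1) * (4 / 3) := by linarith
  refine Integrable.mono'
    (integrable_finsetSum Finset.univ fun j _ => integrableOn_prod_erase_abs_sub_rpow hs hT j)
    (measurable_prod_abs_sub_rpow _).aestronglyMeasurable (ae_of_all _ fun u => ?_)
  have hf : ∀ i : Fin 4, 0 ≤ |u i - u (i + 1)| ^ (H - 1) := fun i => by positivity
  rw [Real.norm_of_nonneg (Finset.prod_nonneg fun i _ => hf i)]
  simpa only [Real.rpow_mul (abs_nonneg _)] using prod_le_sum_prod_erase_rpow hf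

lemma ae_forall_ne_succ : ∀ᵐ u : Fin 4 → ℝ, ∀ i, u i ≠ u (i + 1) := by
  rw [ae_all_iff]
  intro i
  let p : Fin 4 → (Fin 4 → ℝ) →ₗ[ℝ] ℝ := LinearMap.proj
  have hne : (p i - p (i + 1)).ker ≠ ⊤ := by
    intro h
    have : (Pi.single i 1 : Fin 4 → ℝ) ∈ (p i - p (i + 1)).ker := h ▸ trivial
    simp [p] at this
  have hnull := Measure.addHaar_submodule volume _ hne
  filter_upwards [measure_eq_zero_iff_ae_notMem.1 hnull] with u hu heq
  exact hu (by simp [p, heq])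

/-- For `T > 0`, the four-fold cyclic integral
`H ↦ ∫_{[0,T]⁴} ∏_{cyclic} |u_i − u_{i+1}|^{H−1} du` is finite for every `H ∈ (1/4, 1]` and
continuous on `(1/4, 1]`. -/
theorem cyclic_four_fold_integral_finite_and_continuous
    (T : ℝ) (hT : 0 < T) :
    (∀ H ∈ Set.Ioc (1 / 4 : ℝ) 1,
      (∫⁻ u in Set.pi Set.univ (fun _ : Fin 4 => Set.Icc (0 : ℝ) T),
        ENNReal.ofReal (∏ i : Fin 4, |u i - u (i + 1)| ^ (H - 1))) < ⊤) ∧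
    ContinuousOn
      (fun H : ℝ =>
        ∫ u in Set.pi Set.univ (fun _ : Fin 4 => Set.Icc (0 : ℝ) T),
          ∏ i : Fin 4, |u i - u (i + 1)| ^ (H - 1))
      (Set.Ioc (1 / 4 : ℝ) 1) := by
  refine ⟨fun H hH => (integrableOn_prod_abs_sub_rpow hH.1 hT.le).lintegral_lt_top, ?_⟩
  intro H₀ hH₀
  obtain ⟨H₁, hH₁, hH₁₀⟩ := exists_between hH₀.1
  set M : ℝ := max 1 T
  have hM : 1 ≤ M := le_max_left _ _
  refine continuousWithinAt_of_dominated
    (bound := fun u => ∏ i : Fin 4, (|u i - u (i + 1)| ^ (H₁ - 1) * M))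
    (Filter.Eventually.of_forall fun H =>
      (measurable_prod_abs_sub_rpow _).aestronglyMeasurable) ?_ ?_ ?_
  · filter_upwards [self_mem_nhdsWithin, mem_nhdsWithin_of_mem_nhds (Ioi_mem_nhds hH₁₀)]
      with H hH hHH₁
    filter_upwards [ae_restrict_of_ae ae_forall_ne_succ,
      ae_restrict_mem (MeasurableSet.univ_pi fun _ => measurableSet_Icc)] with u hne hu
    rw [Real.norm_of_nonneg (Finset.prod_nonneg fun i _ => by positivity)]
    refine Finset.prod_le_prod (fun i _ => by positivity) fun i _ => ?_
    have hpos : 0 < |u i - u (i + 1)| := abs_pos.2 (sub_ne_zero.2 (hne i))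
    have hle : |u i - u (i + 1)| ≤ M := by
      have a := hu i (mem_univ i)
      have b := hu (i + 1) (mem_univ _)
      refine le_trans (abs_le.2 ⟨?_, ?_⟩) (le_max_right 1 T) <;> linarith [a.1, a.2, b.1, b.2]
    have hHH : H₁ < H := hHH₁
    have hpow : |u i - u (i + 1)| ^ (H - H₁) ≤ M := calc
      _ ≤ M ^ (H - H₁) := Real.rpow_le_rpow hpos.le hle (by linarith)
      _ ≤ M ^ (1 : ℝ) := Real.rpow_le_rpow_of_exponent_le hM (by linarith [hH.2])
      _ = M := Real.rpow_one M
    calc |u i - u (i + 1)| ^ (H - 1)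
        = |u i - u (i + 1)| ^ (H₁ - 1) * |u i - u (i + 1)| ^ (H - H₁) := by
          rw [← Real.rpow_add hpos]; ring_nf
      _ ≤ _ := mul_le_mul_of_nonneg_left hpow (by positivity)
  · simp only [Finset.prod_mul_distrib]
    exact (integrableOn_prod_abs_sub_rpow hH₁ hT.le).mul_const _
  · filter_upwards [ae_restrict_of_ae ae_forall_ne_succ] with u hne
    refine (continuous_finsetProd _ fun i _ => ?_).continuousWithinAt
    exact Real.continuous_const_rpow (abs_pos.2 (sub_ne_zero.2 (hne i))).ne' |>.comp
      (continuous_id.sub continuous_const)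
end

section
/- Let T > 0 and let f : ℝ → ℝ be a bounded measurable function with support contained in [0, T]. Then (2H−1)² ∫_{ℝ⁴} f(u₁) f(u₂) f(u₃) f(u₄) |u₁−u₂|^{H−1} |u₂−u₃|^{H−1} |u₃−u₄|^{H−1} |u₄−u₁|^{H−1} du₁ du₂ du₃ du₄ converges to 0 as H → 1/2 from the right. -/
open MeasureTheory ENNReal Set Filter

/-- A product of `n + 1` nonnegative `n`-th powers is dominated by the sum of the products of
`(n + 1)`-st powers obtained by omitting one factor. -/
lemma prod_pow_le_sum_prod_erase {ι : Type*} [Fintype ι] [DecidableEq ι] {n : ℕ}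
    (hn : Fintype.card ι = n + 1) (z : ι → ℝ) (hz : ∀ i, 0 ≤ z i) :
    ∏ i, z i ^ n ≤ ∑ i, ∏ j ∈ Finset.univ.erase i, z j ^ (n + 1) := by
  have : Nonempty ι := Fintype.card_pos_iff.1 (by omega)
  obtain ⟨i, -, hi⟩ := Finset.exists_min_image Finset.univ z Finset.univ_nonempty
  have hmin : z i ^ n ≤ ∏ j ∈ Finset.univ.erase i, z j := by
    calc z i ^ n = ∏ j ∈ Finset.univ.erase i, z i := by simp [hn]
      _ ≤ _ := Finset.prod_le_prod (fun _ _ => hz i) fun j _ => hi j (Finset.mem_univ j)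
  have hnonneg : ∀ i, 0 ≤ ∏ j ∈ Finset.univ.erase i, z j ^ (n + 1) := fun i =>
    Finset.prod_nonneg fun j _ => pow_nonneg (hz j) _
  calc ∏ i, z i ^ n = z i ^ n * ∏ j ∈ Finset.univ.erase i, z j ^ n :=
        (Finset.mul_prod_erase _ _ (Finset.mem_univ i)).symm
    _ ≤ (∏ j ∈ Finset.univ.erase i, z j) * ∏ j ∈ Finset.univ.erase i, z j ^ n :=
        mul_le_mul_of_nonneg_right hmin (Finset.prod_nonneg fun j _ => pow_nonneg (hz j) _)
    _ = ∏ j ∈ Finset.univ.erase i, z j ^ (n + 1) := by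
        rw [← Finset.prod_mul_distrib]
        exact Finset.prod_congr rfl fun j _ => (pow_succ' _ _).symm
    _ ≤ _ := Finset.single_le_sum (f := fun i => ∏ j ∈ Finset.univ.erase i, z j ^ (n + 1))
        (fun i _ => hnonneg i) (Finset.mem_univ i)

/-- A negative power dominated by a constant plus a more singular power. -/
lemma rpow_le_one_add_rpow {x b c : ℝ} (hx : 0 ≤ x) (hcb : c ≤ b) (hb : b < 0) :
    x ^ b ≤ 1 + x ^ c := by
  have hc : 0 ≤ x ^ c := Real.rpow_nonneg hx c
  rcases hx.eq_or_lt with rfl | hx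
  · rw [Real.zero_rpow hb.ne]; linarith
  rcases le_total x 1 with h | h
  · have := Real.rpow_le_rpow_of_exponent_ge hx h hcb
    linarith
  · have := Real.rpow_le_one_of_one_le_of_nonpos h hb.le
    linarith

/-- The truncated singular kernel is integrable. -/
lemma integrable_indicator_one_add_abs_rpow {T c : ℝ} (hT : 0 ≤ T) (hc : -1 < c) :
    Integrable ((Icc (-T) T).indicator fun x : ℝ => 1 + |x| ^ c) := by
  rw [integrable_indicator_iff measurableSet_Icc]
  have h : IntervalIntegrable (fun x : ℝ => |x| ^ c) volume (-T) T := by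
    refine intervalIntegrable_of_even (by simp) (fun x hx => ?_)
    refine (intervalIntegral.intervalIntegrable_rpow' hc (a := 0) (b := x)).congr ?_
    intro y hy
    rw [uIoc_of_le hx.le] at hy
    simp [abs_of_pos hy.1]
  refine IntegrableOn.add (by simp) ?_
  exact (intervalIntegrable_iff_integrableOn_Icc_of_le (by linarith)).1 h

/-- Integrability of a product of functions of linearly independent linear forms. -/
lemma integrable_prod_comp_mulVec {ι : Type*} [Fintype ι] [DecidableEq ι] (M : Matrix ι ι ℝ)
    (hM : M.det ≠ 0) {g : ι → ℝ → ℝ} (hg : ∀ i, Integrable (g i)) :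
    Integrable fun u : ι → ℝ => ∏ i, g i (M.mulVec u i) := by
  have h : Integrable (fun v : ι → ℝ => ∏ i, g i (v i)) (volume.map (Matrix.toLin' M)) := by
    rw [Real.map_matrix_volume_pi_eq_smul_volume_pi hM]
    exact (Integrable.fintype_prod hg).smul_measure ENNReal.ofReal_ne_top
  exact h.comp_measurable (Matrix.toLin' M).continuous_of_finiteDimensional.measurable

/-- The matrix of the linear forms `u i` and `u j - u (j + 1)` for `j ≠ i`. -/
def cycleMatrix (i : Fin 4) : Matrix (Fin 4) (Fin 4) ℝ :=
  Matrix.of fun j k => (if j = k then 1 else 0) - if j ≠ i ∧ j + 1 = k then 1 else 0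

lemma cycleMatrix_mulVec (i : Fin 4) (u : Fin 4 → ℝ) (j : Fin 4) :
    (cycleMatrix i).mulVec u j = if j = i then u i else u j - u (j + 1) := by
  by_cases h : j = i <;>
    simp [cycleMatrix, Matrix.mulVec, dotProduct, sub_mul, Finset.sum_sub_distrib, h]

lemma det_cycleMatrix_ne_zero (i : Fin 4) : (cycleMatrix i).det ≠ 0 := by
  intro hdet
  obtain ⟨u, hu, h⟩ := Matrix.exists_mulVec_eq_zero_iff.2 hdet
  have h (j : Fin 4) : (if j = i then u i else u j - u (j + 1)) = 0 := by
    rw [← cycleMatrix_mulVec, h, Pi.zero_apply]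
  have h0 := h 0
  have h1 := h 1
  have h2 := h 2
  have h3 := h 3
  apply hu
  ext j
  fin_cases i <;> fin_cases j <;> simp [Fin.ext_iff] at h0 h1 h2 h3 ⊢ <;> linarith

/-- Opening the cycle at a vertex leaves an integrable kernel. -/
lemma integrable_mul_prod_erase {g k : ℝ → ℝ} (hg : Integrable g) (hk : Integrable k)
    (i : Fin 4) :
    Integrable fun u : Fin 4 → ℝ =>
      g (u i) * ∏ j ∈ Finset.univ.erase i, k (u j - u (j + 1)) := by
  have h := integrable_prod_comp_mulVec (cycleMatrix i) (det_cycleMatrix_ne_zero i)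
    (g := fun j => if j = i then g else k) (fun j => by split_ifs <;> assumption)
  refine h.congr (Eventually.of_forall fun u => ?_)
  simp only [cycleMatrix_mulVec]
  rw [← Finset.mul_prod_erase _ _ (Finset.mem_univ i)]
  simp only [if_true]
  congr 1
  refine Finset.prod_congr rfl fun j hj => ?_
  simp [Finset.ne_of_mem_erase hj]

/-- Pointwise domination of the cyclic kernel, uniformly in `H ∈ (1/2, 1)`. -/
lemma prod_abs_rpow_le (u : Fin 4 → ℝ) {H : ℝ} (h₁ : 1 / 2 < H) (h₂ : H < 1) :
    ∏ i : Fin 4, |u i - u (i + 1)| ^ (H - 1) ≤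
      ∑ i, ∏ j ∈ Finset.univ.erase i, (1 + |u j - u (j + 1)| ^ (-(2 / 3) : ℝ)) := by
  have hpow (n : ℕ) (x : ℝ) : (|x| ^ ((H - 1) / 3)) ^ n = |x| ^ ((H - 1) / 3 * n) := by
    rw [Real.rpow_mul (abs_nonneg x), Real.rpow_natCast]
  calc ∏ i : Fin 4, |u i - u (i + 1)| ^ (H - 1)
      = ∏ i : Fin 4, (|u i - u (i + 1)| ^ ((H - 1) / 3)) ^ 3 := by
        refine Finset.prod_congr rfl fun i _ => ?_
        rw [hpow]
        congr 1
        push_cast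
        ring
    _ ≤ ∑ i, ∏ j ∈ Finset.univ.erase i, (|u j - u (j + 1)| ^ ((H - 1) / 3)) ^ (3 + 1) :=
        prod_pow_le_sum_prod_erase (Fintype.card_fin 4) (fun i : Fin 4 => |u i - u (i + 1)| ^ ((H - 1) / 3))
          fun i => by positivity
    _ ≤ _ := by
        refine Finset.sum_le_sum fun i _ => Finset.prod_le_prod (fun j _ => by positivity) ?_
        intro j _
        rw [hpow]
        push_cast
        exact rpow_le_one_add_rpow (abs_nonneg _) (by linarith) (by linarith)

/-- For `f` bounded measurable with support in `[0,T]`, the quantity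
`(2H−1)² ∫_{ℝ⁴} f(u₁)⋯f(u₄) ∏_{cyclic} |u_i − u_{i+1}|^{H−1} du` converges to `0` as
`H → 1/2` from the right. -/
theorem fourth_cumulant_tendsto_zero_of_H_to_half
    (T : ℝ) (hT : 0 < T)
    (f : ℝ → ℝ) (hf : Measurable f) (hb : ∃ C : ℝ, ∀ x : ℝ, |f x| ≤ C)
    (hsupp : Function.support f ⊆ Set.Icc (0 : ℝ) T) :
    Filter.Tendsto
      (fun H : ℝ =>
        (2 * H - 1) ^ 2 *
          ∫ u : Fin 4 → ℝ,
            (∏ i : Fin 4, f (u i)) * ∏ i : Fin 4, |u i - u (i + 1)| ^ (H - 1))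
      (nhdsWithin (1 / 2) (Set.Ioi (1 / 2 : ℝ)))
      (nhds 0) := by
  obtain ⟨C, hC⟩ := hb
  set g : ℝ → ℝ := (Icc (0 : ℝ) T).indicator 1
  set k : ℝ → ℝ := (Icc (-T) T).indicator fun x : ℝ => 1 + |x| ^ (-(2 / 3) : ℝ)
  have hg : Integrable g := by
    rw [integrable_indicator_iff measurableSet_Icc]
    exact integrableOn_const (by simp)
  have hk : Integrable k := integrable_indicator_one_add_abs_rpow hT.le (by norm_num)
  set G : (Fin 4 → ℝ) → ℝ := fun u =>
    C ^ 4 * ∑ i, g (u i) * ∏ j ∈ Finset.univ.erase i, k (u j - u (j + 1))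
  have hG : Integrable G :=
    (integrable_finsetSum _ fun i _ => integrable_mul_prod_erase hg hk i).const_mul _
  have hC0 : 0 ≤ C := (abs_nonneg _).trans (hC 0)
  have hgnn (x : ℝ) : 0 ≤ g x := indicator_nonneg (fun _ _ => zero_le_one) x
  have hknn (x : ℝ) : 0 ≤ k x := indicator_nonneg (fun _ _ => by positivity) x
  have hbound {H : ℝ} (h₁ : 1 / 2 < H) (h₂ : H < 1) (u : Fin 4 → ℝ) :
      ‖(∏ i : Fin 4, f (u i)) * ∏ i : Fin 4, |u i - u (i + 1)| ^ (H - 1)‖ ≤ G u := by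
    by_cases hu : ∀ i, u i ∈ Icc 0 T
    · have hP : 0 ≤ ∏ i : Fin 4, |u i - u (i + 1)| ^ (H - 1) :=
        Finset.prod_nonneg fun i _ => by positivity
      rw [norm_mul, Real.norm_of_nonneg hP]
      refine mul_le_mul ?_ ((prod_abs_rpow_le u h₁ h₂).trans_eq ?_)
        hP (by positivity)
      · rw [norm_prod]
        exact (Finset.prod_le_prod (fun _ _ => norm_nonneg _) fun i _ => hC (u i)).trans_eq
          (by simp)
      · refine Finset.sum_congr rfl fun i _ => ?_
        have : g (u i) = 1 := indicator_of_mem (hu i) _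
        rw [this, one_mul]
        refine Finset.prod_congr rfl fun j _ => ?_
        have h1 := hu j
        have h2 := hu (j + 1)
        have hmem : u j - u (j + 1) ∈ Icc (-T) T :=
          ⟨by linarith [h1.1, h2.2], by linarith [h1.2, h2.1]⟩
        exact (indicator_of_mem hmem fun x : ℝ => 1 + |x| ^ (-(2 / 3) : ℝ)).symm
    · push Not at hu
      obtain ⟨i, hi⟩ := hu
      have : f (u i) = 0 := by
        by_contra h
        exact hi (hsupp h)
      rw [Finset.prod_eq_zero (Finset.mem_univ i) this, zero_mul, norm_zero]
      exact mul_nonneg (by positivity) (Finset.sum_nonneg fun i _ =>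
        mul_nonneg (hgnn _) (Finset.prod_nonneg fun _ _ => hknn _))
  refine squeeze_zero_norm' (a := fun H : ℝ => (2 * H - 1) ^ 2 * ∫ u, G u) ?_ ?_
  · filter_upwards [Ioo_mem_nhdsGT (show (1 / 2 : ℝ) < 1 by norm_num)] with H hH
    rw [norm_mul, Real.norm_of_nonneg (sq_nonneg _)]
    exact mul_le_mul_of_nonneg_left
      (norm_integral_le_of_norm_le hG (Eventually.of_forall (hbound hH.1 hH.2))) (sq_nonneg _)
  · have : Continuous fun H : ℝ => (2 * H - 1) ^ 2 * ∫ u, G u := by fun_prop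
    simpa using (this.tendsto (1 / 2)).mono_left nhdsWithin_le_nhds
end

section
/- Let λ > 0, K ≥ 0 and H ∈ (1/2, 1). Then H(2H−1) ∫₀^∞ e^{−λv} ( ∫_{v+K}^∞ e^{−λu} (u − v − K)^{2H−2} du ) dv = e^{−λK} · H · Γ(2H) / (2 λ^{2H}), where Γ is the Gamma function. Consequently this quantity converges to e^{−λK}/(4λ) as H → 1/2 from the right. -/
open MeasureTheory Set Filter

theorem integral_Ioi_comp_add_right (f : ℝ → ℝ) (a : ℝ) :
    ∫ x in Ioi (0 : ℝ), f (x + a) = ∫ x in Ioi a, f x := by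
  have h := (measurePreserving_add_right volume a).setIntegral_preimage_emb
    (measurableEmbedding_addRight a) f (Ioi a)
  simpa using h

theorem integral_exp_neg_mul_mul_sub_rpow_Ioi {r s : ℝ} (hr : 0 < r) (hs : 0 < s) (a : ℝ) :
    ∫ u in Ioi a, Real.exp (-r * u) * (u - a) ^ (s - 1)
      = Real.exp (-r * a) * ((1 / r) ^ s * Real.Gamma s) := by
  rw [← integral_Ioi_comp_add_right, ← Real.integral_rpow_mul_exp_neg_mul_Ioi hs hr,
    ← integral_const_mul]
  congr 1 with x
  rw [add_sub_cancel_right, mul_add, Real.exp_add, neg_mul r x]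
  ring

theorem mul_integral_exp_mul_integral_exp_mul_sub_rpow {r H : ℝ} (hr : 0 < r)
    (hH : 1 / 2 < H) (K : ℝ) :
    (H * (2 * H - 1) *
        ∫ v in Ioi (0 : ℝ), Real.exp (-r * v) *
          ∫ u in Ioi (v + K), Real.exp (-r * u) * (u - v - K) ^ (2 * H - 2))
      = Real.exp (-r * K) * H * Real.Gamma (2 * H) / (2 * r ^ (2 * H)) := by
  have hs : 0 < 2 * H - 1 := by linarith
  have inner (v : ℝ) : Real.exp (-r * v) *
        ∫ u in Ioi (v + K), Real.exp (-r * u) * (u - v - K) ^ (2 * H - 2)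
      = Real.exp (-r * K) * ((1 / r) ^ (2 * H - 1) * Real.Gamma (2 * H - 1)) *
        Real.exp (-(2 * r) * v) := by
    have h := integral_exp_neg_mul_mul_sub_rpow_Ioi hr hs (v + K)
    simp only [← sub_sub, show 2 * H - 1 - 1 = 2 * H - 2 by ring] at h
    rw [h, mul_add, Real.exp_add, show -(2 * r) * v = -r * v + -r * v by ring, Real.exp_add]
    ring
  have hGamma : Real.Gamma (2 * H) = (2 * H - 1) * Real.Gamma (2 * H - 1) := by
    rw [← Real.Gamma_add_one hs.ne', sub_add_cancel]
  have hpow : r ^ (2 * H) = r ^ (2 * H - 1) * r := by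
    rw [← Real.rpow_add_one hr.ne', sub_add_cancel]
  have hpos : r ^ (2 * H - 1) ≠ 0 := (Real.rpow_pos_of_pos hr _).ne'
  simp only [inner]
  rw [integral_const_mul, integral_exp_mul_Ioi (by linarith), hGamma, hpow, one_div,
    Real.inv_rpow hr.le, mul_zero, Real.exp_zero]
  field_simp

/-- For `λ > 0`, `K ≥ 0` and `H ∈ (1/2, 1)`,
`H(2H−1) ∫₀^∞ e^{−λv} (∫_{v+K}^∞ e^{−λu} (u−v−K)^{2H−2} du) dv = e^{−λK} H Γ(2H)/(2λ^{2H})`,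
and consequently this quantity converges to `e^{−λK}/(4λ)` as `H → 1/2` from the right. -/
theorem stationary_rou_covariance_term_I1
    (lam K H : ℝ) (hlam : 0 < lam) (hK : 0 ≤ K) (hH : H ∈ Set.Ioo (1 / 2 : ℝ) 1) :
    (H * (2 * H - 1) *
        ∫ v in Set.Ioi (0 : ℝ), Real.exp (-lam * v) *
          ∫ u in Set.Ioi (v + K), Real.exp (-lam * u) * (u - v - K) ^ (2 * H - 2))
      = Real.exp (-lam * K) * H * Real.Gamma (2 * H) / (2 * lam ^ (2 * H)) ∧
    Filter.Tendsto
      (fun H' : ℝ =>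
        H' * (2 * H' - 1) *
          ∫ v in Set.Ioi (0 : ℝ), Real.exp (-lam * v) *
            ∫ u in Set.Ioi (v + K), Real.exp (-lam * u) * (u - v - K) ^ (2 * H' - 2))
      (nhdsWithin (1 / 2) (Set.Ioo (1 / 2 : ℝ) 1))
      (nhds (Real.exp (-lam * K) / (4 * lam))) := by
  refine ⟨mul_integral_exp_mul_integral_exp_mul_sub_rpow hlam hH.1 K, ?_⟩
  have hcont : ContinuousAt (fun x : ℝ =>
      Real.exp (-lam * K) * x * Real.Gamma (2 * x) / (2 * lam ^ (2 * x))) (1 / 2) := by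
    have hGamma : ContinuousAt (fun x : ℝ => Real.Gamma (2 * x)) (1 / 2) := by
      refine ContinuousAt.comp (g := Real.Gamma) ?_ (by fun_prop)
      refine (Real.differentiableAt_Gamma fun m => ?_).continuousAt
      have : (0 : ℝ) ≤ m := m.cast_nonneg
      linarith
    have hpow : ContinuousAt (fun x : ℝ => lam ^ (2 * x)) (1 / 2) :=
      ContinuousAt.rpow (by fun_prop) (by fun_prop) (Or.inl hlam.ne')
    exact ((by fun_prop : ContinuousAt (fun x : ℝ => Real.exp (-lam * K) * x) _).mul hGamma).div
      (continuousAt_const.mul hpow) (by positivity)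
  have hval : Real.exp (-lam * K) * (1 / 2) * Real.Gamma (2 * (1 / 2)) /
      (2 * lam ^ (2 * (1 / 2) : ℝ)) = Real.exp (-lam * K) / (4 * lam) := by
    rw [show (2 * (1 / 2) : ℝ) = 1 by norm_num, Real.Gamma_one, Real.rpow_one]
    field_simp
    norm_num
  have hlim := hcont.tendsto.mono_left (nhdsWithin_le_nhds (s := Ioo (1 / 2 : ℝ) 1))
  rw [hval] at hlim
  refine hlim.congr' ?_
  filter_upwards [self_mem_nhdsWithin] with x hx
  exact (mul_integral_exp_mul_integral_exp_mul_sub_rpow hlam hx.1 K).symm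
end

section
/- Let λ > 0 and K ≥ 0. Then H(2H−1) ∫₀^∞ e^{−λv} ( ∫₀^{v+K} e^{−λu} (v + K − u)^{2H−2} du ) dv converges to e^{−λK}/(4λ) as H → 1/2 from the right. -/
open MeasureTheory Set Filter

/-- Integration by parts for the convolution of an exponential with a power. -/
theorem mul_integral_exp_mul_sub_rpow {lam a t : ℝ} (hlam : 0 < lam) (ha : 0 < a) (ht : 0 < t) :
    a * ∫ u in Ioo 0 t, Real.exp (-lam * u) * (t - u) ^ (a - 1) =
      t ^ a - lam * ∫ u in Ioo 0 t, Real.exp (-lam * u) * (t - u) ^ a := by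
  have hcont : Continuous fun u : ℝ => (t - u) ^ a :=
    (continuous_const.sub continuous_id).rpow_const fun _ => Or.inr ha.le
  have hexp : Continuous fun u : ℝ => Real.exp (-lam * u) := by fun_prop
  have hF : Continuous fun u : ℝ => Real.exp (-lam * u) * (t - u) ^ a := hexp.mul hcont
  have hderiv : ∀ u ∈ Ioo 0 t, HasDerivAt (fun u => -(Real.exp (-lam * u) * (t - u) ^ a))
      (lam * (Real.exp (-lam * u) * (t - u) ^ a) +
        a * (Real.exp (-lam * u) * (t - u) ^ (a - 1))) u := by
    intro u hu
    have h1 : HasDerivAt (fun u : ℝ => Real.exp (-lam * u)) (Real.exp (-lam * u) * (-lam * 1)) u :=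
      ((hasDerivAt_id u).const_mul (-lam)).exp
    have h2 : HasDerivAt (fun u : ℝ => (t - u) ^ a) (-1 * a * (t - u) ^ (a - 1)) u :=
      ((hasDerivAt_id u).const_sub t).rpow_const (Or.inl (sub_pos.2 hu.2).ne')
    exact (h1.mul h2).neg.congr_deriv (by ring)
  have hint := intervalIntegral.integrableOn_deriv_of_nonneg (hF.neg.continuousOn) hderiv (by
    intro u hu
    have : 0 < t - u := sub_pos.2 hu.2
    positivity)
  have hFint : IntegrableOn (fun u : ℝ => lam * (Real.exp (-lam * u) * (t - u) ^ a)) (Ioc 0 t) :=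
    ((hF.const_mul lam).integrableOn_Icc).mono_set Ioc_subset_Icc_self
  have hGint : IntegrableOn (fun u : ℝ => a * (Real.exp (-lam * u) * (t - u) ^ (a - 1)))
      (Ioc 0 t) := by
    refine (hint.sub hFint).congr (Eventually.of_forall fun u => ?_)
    simp
  have hftc := intervalIntegral.integral_eq_sub_of_hasDerivAt_of_le ht.le hF.neg.continuousOn hderiv
    ((intervalIntegrable_iff_integrableOn_Ioc_of_le ht.le).2 hint)
  rw [intervalIntegral.integral_of_le ht.le, integral_add hFint hGint, integral_const_mul,
    integral_const_mul, integral_Ioc_eq_integral_Ioo, integral_Ioc_eq_integral_Ioo] at hftc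
  simp [Real.zero_rpow ha.ne'] at hftc
  simp only [neg_mul]
  linarith

theorem integral_exp_mul_sub_rpow_nonneg (lam a t : ℝ) :
    0 ≤ ∫ u in Ioo 0 t, Real.exp (-lam * u) * (t - u) ^ a :=
  setIntegral_nonneg measurableSet_Ioo fun _ hu =>
    mul_nonneg (Real.exp_pos _).le (Real.rpow_nonneg (sub_pos.2 hu.2).le _)

theorem rpow_le_one_add {x a : ℝ} (hx : 0 ≤ x) (ha : 0 ≤ a) (ha1 : a ≤ 1) : x ^ a ≤ 1 + x := by
  rcases le_total x 1 with h | h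
  · linarith [Real.rpow_le_one hx h ha]
  · linarith [Real.rpow_le_self_of_one_le h ha1]

theorem tendsto_rpow_nhdsGT_zero {x : ℝ} (hx : 0 < x) :
    Tendsto (fun a : ℝ => x ^ a) (nhdsWithin 0 (Ioi 0)) (nhds 1) := by
  have h := (Real.continuousAt_const_rpow (b := 0) hx.ne').tendsto
  rw [Real.rpow_zero] at h
  exact h.mono_left nhdsWithin_le_nhds

theorem eventually_mem_Ioo_nhdsGT_zero : ∀ᶠ a : ℝ in nhdsWithin 0 (Ioi 0), a ∈ Ioo (0 : ℝ) 1 :=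
  Ioo_mem_nhdsGT one_pos

theorem integral_exp_Ioo {lam t : ℝ} (hlam : 0 < lam) (ht : 0 ≤ t) :
    lam * ∫ u in Ioo 0 t, Real.exp (-lam * u) = 1 - Real.exp (-lam * t) := by
  rw [← integral_Ioc_eq_integral_Ioo, ← intervalIntegral.integral_of_le ht,
    intervalIntegral.integral_comp_mul_left (fun u => Real.exp u) (neg_ne_zero.2 hlam.ne'),
    integral_exp]
  simp
  field_simp
  ring

/-- The kernels `a * w ^ (a - 1)` concentrate at `w = 0` as `a → 0⁺`. -/
theorem tendsto_mul_integral_exp_mul_sub_rpow {lam t : ℝ} (hlam : 0 < lam) (ht : 0 < t) :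
    Tendsto (fun a : ℝ => a * ∫ u in Ioo 0 t, Real.exp (-lam * u) * (t - u) ^ (a - 1))
      (nhdsWithin 0 (Ioi 0)) (nhds (Real.exp (-lam * t))) := by
  have hlim : Tendsto (fun a : ℝ => ∫ u in Ioo 0 t, Real.exp (-lam * u) * (t - u) ^ a)
      (nhdsWithin 0 (Ioi 0)) (nhds (∫ u in Ioo 0 t, Real.exp (-lam * u))) := by
    refine tendsto_integral_filter_of_dominated_convergence (fun _ => 1 + t) ?_ ?_ ?_ ?_
    · exact Eventually.of_forall fun a => by
        have : Measurable fun u : ℝ => Real.exp (-lam * u) * (t - u) ^ a := by fun_prop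
        exact this.aestronglyMeasurable
    · filter_upwards [eventually_mem_Ioo_nhdsGT_zero] with a ha
      refine (ae_restrict_iff' measurableSet_Ioo).2 (Eventually.of_forall fun u hu => ?_)
      have hw : 0 ≤ t - u := (sub_pos.2 hu.2).le
      rw [Real.norm_of_nonneg (by positivity)]
      have h1 : Real.exp (-lam * u) ≤ 1 := Real.exp_le_one_iff.2 (by nlinarith [hu.1])
      have h2 := rpow_le_one_add hw ha.1.le ha.2.le
      calc _ ≤ 1 * (t - u) ^ a := by gcongr
        _ ≤ 1 + t := by linarith [hu.1]
    · exact integrable_const _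
    · refine (ae_restrict_iff' measurableSet_Ioo).2 (Eventually.of_forall fun u hu => ?_)
      simpa using (tendsto_rpow_nhdsGT_zero (sub_pos.2 hu.2)).const_mul (Real.exp (-lam * u))
  have h := (tendsto_rpow_nhdsGT_zero ht).sub (hlim.const_mul lam)
  rw [integral_exp_Ioo hlam ht.le, sub_sub_cancel] at h
  refine h.congr' ?_
  filter_upwards [self_mem_nhdsWithin] with a ha
  exact (mul_integral_exp_mul_sub_rpow hlam ha ht).symm

theorem stronglyMeasurable_integral_exp_mul_sub_rpow (lam b : ℝ) :
    StronglyMeasurable fun t : ℝ => ∫ u in Ioo 0 t, Real.exp (-lam * u) * (t - u) ^ b := by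
  have hset : MeasurableSet {p : ℝ × ℝ | p.2 ∈ Ioo 0 p.1} :=
    (measurableSet_lt measurable_const measurable_snd).inter
      (measurableSet_lt measurable_snd measurable_fst)
  have hf : Measurable fun p : ℝ × ℝ => Real.exp (-lam * p.2) * (p.1 - p.2) ^ b := by fun_prop
  have h := (hf.indicator hset).stronglyMeasurable.integral_prod_right' (ν := volume)
  convert h using 2 with t
  rw [← integral_indicator measurableSet_Ioo]
  rfl

theorem integrableOn_exp_mul_one_add {lam : ℝ} (K : ℝ) (hlam : 0 < lam) :
    IntegrableOn (fun v : ℝ => Real.exp (-lam * v) * (1 + (v + K))) (Ioi 0) := by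
  have h0 : IntegrableOn (fun v : ℝ => Real.exp (-lam * v)) (Ioi 0) :=
    exp_neg_integrableOn_Ioi 0 hlam
  have h1 : IntegrableOn (fun v : ℝ => v ^ (1 : ℝ) * Real.exp (-lam * v)) (Ioi 0) := by
    simpa using
      integrableOn_rpow_mul_exp_neg_mul_rpow (p := 1) (s := 1) (by norm_num) one_pos hlam
  refine ((h0.mul_const (1 + K)).add h1).congr (Eventually.of_forall fun v => ?_)
  simp only [Pi.add_apply, Real.rpow_one]
  ring

theorem tendsto_mul_integral_integral_exp_mul_sub_rpow {lam K : ℝ} (hlam : 0 < lam) (hK : 0 ≤ K) :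
    Tendsto (fun a : ℝ => ∫ v in Ioi (0 : ℝ), Real.exp (-lam * v) *
        (a * ∫ u in Ioo 0 (v + K), Real.exp (-lam * u) * (v + K - u) ^ (a - 1)))
      (nhdsWithin 0 (Ioi 0)) (nhds (Real.exp (-lam * K) / (2 * lam))) := by
  have hval : ∫ v in Ioi (0 : ℝ), Real.exp (-lam * v) * Real.exp (-lam * (v + K)) =
      Real.exp (-lam * K) / (2 * lam) := by
    have h : ∀ v : ℝ, Real.exp (-lam * v) * Real.exp (-lam * (v + K)) =
        Real.exp (-lam * K) * Real.exp (-(2 * lam) * v) := fun v => by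
      rw [← Real.exp_add, ← Real.exp_add]
      ring_nf
    simp_rw [h]
    rw [integral_const_mul, integral_exp_mul_Ioi (by linarith)]
    simp
    field_simp
  rw [← hval]
  refine tendsto_integral_filter_of_dominated_convergence
    (fun v => Real.exp (-lam * v) * (1 + (v + K))) ?_ ?_ (integrableOn_exp_mul_one_add K hlam) ?_
  · refine Eventually.of_forall fun a => ?_
    have h := (stronglyMeasurable_integral_exp_mul_sub_rpow lam (a - 1)).comp_measurable
      (measurable_id.add_const K)
    have hexp : Continuous fun v : ℝ => Real.exp (-lam * v) := by fun_prop
    exact (hexp.stronglyMeasurable.mul (h.const_mul a)).aestronglyMeasurable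
  · filter_upwards [eventually_mem_Ioo_nhdsGT_zero] with a ha
    refine (ae_restrict_iff' measurableSet_Ioi).2 (Eventually.of_forall fun v hv => ?_)
    have ht : 0 < v + K := add_pos_of_pos_of_nonneg hv hK
    have hnn := mul_nonneg ha.1.le (integral_exp_mul_sub_rpow_nonneg lam (a - 1) (v + K))
    rw [Real.norm_of_nonneg (mul_nonneg (Real.exp_pos _).le hnn),
      mul_integral_exp_mul_sub_rpow hlam ha.1 ht]
    have h1 := mul_nonneg hlam.le (integral_exp_mul_sub_rpow_nonneg lam a (v + K))
    have h2 := rpow_le_one_add ht.le ha.1.le ha.2.le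
    gcongr
    linarith
  · refine (ae_restrict_iff' measurableSet_Ioi).2 (Eventually.of_forall fun v hv => ?_)
    exact (tendsto_mul_integral_exp_mul_sub_rpow hlam
      (add_pos_of_pos_of_nonneg hv hK)).const_mul _

/-- For `λ > 0` and `K ≥ 0`, `H(2H−1) ∫₀^∞ e^{−λv} (∫₀^{v+K} e^{−λu} (v+K−u)^{2H−2} du) dv`
converges to `e^{−λK}/(4λ)` as `H → 1/2` from the right. -/
theorem stationary_rou_covariance_term_I2
    (lam K : ℝ) (hlam : 0 < lam) (hK : 0 ≤ K) :
    Filter.Tendsto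
      (fun H : ℝ =>
        H * (2 * H - 1) *
          ∫ v in Set.Ioi (0 : ℝ), Real.exp (-lam * v) *
            ∫ u in Set.Ioo (0 : ℝ) (v + K), Real.exp (-lam * u) * (v + K - u) ^ (2 * H - 2))
      (nhdsWithin (1 / 2) (Set.Ioi (1 / 2 : ℝ)))
      (nhds (Real.exp (-lam * K) / (4 * lam))) := by
  have hsub : Tendsto (fun H : ℝ => 2 * H - 1) (nhdsWithin (1 / 2) (Ioi (1 / 2 : ℝ)))
      (nhdsWithin 0 (Ioi 0)) := by
    refine tendsto_nhdsWithin_iff.2 ⟨?_, ?_⟩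
    · have h : Continuous fun H : ℝ => 2 * H - 1 := by fun_prop
      have h' := h.tendsto (1 / 2)
      norm_num at h'
      exact h'.mono_left nhdsWithin_le_nhds
    · filter_upwards [self_mem_nhdsWithin] with H hH
      simp only [mem_Ioi] at hH ⊢
      linarith
  have hid : Tendsto (fun H : ℝ => H) (nhdsWithin (1 / 2) (Ioi (1 / 2 : ℝ))) (nhds (1 / 2)) :=
    tendsto_id.mono_left nhdsWithin_le_nhds
  have h := hid.mul ((tendsto_mul_integral_integral_exp_mul_sub_rpow hlam hK).comp hsub)
  rw [show 1 / 2 * (Real.exp (-lam * K) / (2 * lam)) = Real.exp (-lam * K) / (4 * lam) by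
    field_simp; norm_num] at h
  refine h.congr fun H => ?_
  simp only [Function.comp_apply]
  rw [mul_assoc, ← integral_const_mul (2 * H - 1)]
  simp only [mul_left_comm (2 * H - 1), show 2 * H - 1 - 1 = 2 * H - 2 by ring]
end

section
/- Let λ > 0 and K ∈ ℝ. Then I(H) := H(2H−1) ∫₀^∞ ∫₀^∞ e^{−λu} e^{−λv} |u − v − K|^{2H−2} du dv converges to e^{−λ|K|}/(2λ) as H → 1/2 from the right. -/
open MeasureTheory Set Filter

/-- Up to normalization, the law of the difference of two independent exponential
variables is the Laplace law. -/
lemma setIntegral_exp_mul_exp_comp_sub {lam : ℝ} (hlam : 0 < lam) {h : ℝ → ℝ}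
    (hm : Measurable h) (h0 : ∀ x, 0 ≤ h x) :
    ∫ p in Ioi (0 : ℝ) ×ˢ Ioi (0 : ℝ),
        Real.exp (-lam * p.1) * Real.exp (-lam * p.2) * h (p.1 - p.2) =
      ∫ x, Real.exp (-lam * |x|) / (2 * lam) * h x := by
  have hQ : MeasurableSet (Ioi (0 : ℝ) ×ˢ Ioi (0 : ℝ)) := measurableSet_Ioi.prod measurableSet_Ioi
  rw [integral_eq_lintegral_of_nonneg_ae
      (Eventually.of_forall fun p => by have := h0 (p.1 - p.2); positivity)
      (by fun_prop),
    integral_eq_lintegral_of_nonneg_ae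
      (Eventually.of_forall fun x => by have := h0 x; positivity)
      (by fun_prop)]
  congr 1
  rw [← lintegral_indicator hQ, Measure.volume_eq_prod, lintegral_prod_symm' _
    (Measurable.indicator (by fun_prop) hQ)]
  have hshift : ∀ y : ℝ, ∫⁻ x, (Ioi (0 : ℝ) ×ˢ Ioi (0 : ℝ)).indicator (fun p : ℝ × ℝ =>
        ENNReal.ofReal (Real.exp (-lam * p.1) * Real.exp (-lam * p.2) * h (p.1 - p.2))) (x, y) =
      ∫⁻ x, (Ioi (0 : ℝ) ×ˢ Ioi (0 : ℝ)).indicator (fun p : ℝ × ℝ =>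
        ENNReal.ofReal (Real.exp (-lam * p.1) * Real.exp (-lam * p.2) * h (p.1 - p.2)))
        (x + y, y) := fun y =>
    (lintegral_add_right_eq_self (fun x => (Ioi (0 : ℝ) ×ˢ Ioi (0 : ℝ)).indicator
      (fun p : ℝ × ℝ => ENNReal.ofReal
        (Real.exp (-lam * p.1) * Real.exp (-lam * p.2) * h (p.1 - p.2))) (x, y)) y).symm
  simp_rw [hshift]
  rw [lintegral_lintegral_swap]
  swap
  · refine Measurable.aemeasurable ?_
    exact (Measurable.indicator (f := fun p : ℝ × ℝ => ENNReal.ofReal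
      (Real.exp (-lam * p.1) * Real.exp (-lam * p.2) * h (p.1 - p.2))) (by fun_prop) hQ).comp
      (g := _) (f := fun q : ℝ × ℝ => (q.2 + q.1, q.1)) (by fun_prop)
  refine lintegral_congr fun x => ?_
  have hslice : ∀ y : ℝ, (Ioi (0 : ℝ) ×ˢ Ioi (0 : ℝ)).indicator (fun p : ℝ × ℝ =>
        ENNReal.ofReal (Real.exp (-lam * p.1) * Real.exp (-lam * p.2) * h (p.1 - p.2)))
        (x + y, y) =
      (Ioi (max 0 (-x))).indicator (fun y => ENNReal.ofReal (Real.exp (-lam * x) * h x) *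
        ENNReal.ofReal (Real.exp (-(2 * lam) * y))) y := by
    intro y
    have hiff : (x + y, y) ∈ Ioi (0 : ℝ) ×ˢ Ioi (0 : ℝ) ↔ y ∈ Ioi (max 0 (-x)) := by
      simp only [mem_prod, mem_Ioi, max_lt_iff]
      constructor <;> rintro ⟨h1, h2⟩ <;> constructor <;> linarith
    by_cases hy : y ∈ Ioi (max 0 (-x))
    · rw [indicator_of_mem hy, indicator_of_mem (hiff.2 hy),
        ← ENNReal.ofReal_mul (mul_nonneg (Real.exp_pos _).le (h0 x))]
      congr 1
      simp only [add_sub_cancel_right]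
      rw [← Real.exp_add, mul_right_comm, ← Real.exp_add]
      ring_nf
    · rw [indicator_of_notMem hy, indicator_of_notMem (fun hh => hy (hiff.1 hh))]
  simp_rw [hslice]
  have hneg : -(2 * lam) < 0 := by linarith
  rw [lintegral_indicator measurableSet_Ioi, lintegral_const_mul _ (by fun_prop),
    ← ofReal_integral_eq_lintegral_ofReal (integrableOn_exp_mul_Ioi hneg _)
      (Eventually.of_forall fun y => (Real.exp_pos _).le),
    integral_exp_mul_Ioi hneg, ← ENNReal.ofReal_mul (mul_nonneg (Real.exp_pos _).le (h0 x))]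
  congr 1
  have hexp : Real.exp (-lam * |x|) =
      Real.exp (-lam * x) * Real.exp (-(2 * lam) * max 0 (-x)) := by
    rw [← Real.exp_add]
    congr 1
    rcases le_total 0 x with hx | hx
    · rw [abs_of_nonneg hx, max_eq_left (by linarith)]; ring
    · rw [abs_of_nonpos hx, max_eq_right (by linarith)]; ring
  rw [hexp, neg_div_neg_eq]
  ring

/-- The measures `ε x ^ (ε - 1) dx` on `(0, ∞)` concentrate at `0` as `ε → 0⁺`. -/
lemma tendsto_mul_setIntegral_Ioi_rpow_sub_one {lam C : ℝ} (hlam : 0 < lam) {φ : ℝ → ℝ}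
    (hφ : Continuous φ) (hb : ∀ x, |φ x| ≤ C * Real.exp (-lam * |x|)) :
    Tendsto (fun ε : ℝ => ε * ∫ x in Ioi (0 : ℝ), φ x * |x| ^ (ε - 1))
      (nhdsWithin 0 (Ioi 0)) (nhds (φ 0)) := by
  have hC : 0 ≤ C := by simpa using (abs_nonneg _).trans (hb 0)
  have hsub : ∀ ε ∈ Ioi (0 : ℝ), ∫ y in Ioi (0 : ℝ), φ (y ^ ε⁻¹) =
      ε * ∫ x in Ioi (0 : ℝ), φ x * |x| ^ (ε - 1) := by
    intro ε hε
    have hε : 0 < ε := hε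
    rw [← integral_comp_rpow_Ioi _ hε.ne', ← integral_const_mul]
    refine setIntegral_congr_fun measurableSet_Ioi fun x hx => ?_
    have hx : 0 < x := hx
    simp only [smul_eq_mul]
    rw [← Real.rpow_mul hx.le, mul_inv_cancel₀ hε.ne', Real.rpow_one, abs_of_pos hε,
      abs_of_pos hx]
    ring
  refine Tendsto.congr' (eventually_mem_nhdsWithin.mono hsub) ?_
  have hlim : ∫ y in Ioi (0 : ℝ), (Iio (1 : ℝ)).indicator (fun _ => φ 0) y = φ 0 := by
    rw [integral_indicator measurableSet_Iio, Measure.restrict_restrict measurableSet_Iio,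
      Iio_inter_Ioi]
    simp
  rw [← hlim]
  have hle1 : ∀ᶠ ε : ℝ in nhdsWithin 0 (Ioi 0), ε ∈ Ioc (0 : ℝ) 1 :=
    Ioc_mem_nhdsGT one_pos
  refine tendsto_integral_filter_of_dominated_convergence
    (fun y => (Iio (1 : ℝ)).indicator (fun _ => C) y + C * Real.exp (-lam * y)) ?_ ?_ ?_ ?_
  · filter_upwards with ε
    exact (hφ.measurable.comp (by fun_prop)).aestronglyMeasurable
  · filter_upwards [hle1] with ε hε
    filter_upwards [ae_restrict_mem measurableSet_Ioi] with y hy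
    have hy : 0 < y := hy
    rw [Real.norm_eq_abs]
    refine (hb _).trans ?_
    rcases lt_or_ge y 1 with h1 | h1
    · rw [indicator_of_mem (show y ∈ Iio (1 : ℝ) from h1)]
      have : Real.exp (-lam * |y ^ ε⁻¹|) ≤ 1 := by
        rw [Real.exp_le_one_iff]
        nlinarith [abs_nonneg (y ^ ε⁻¹)]
      nlinarith [mul_nonneg hC (Real.exp_pos (-lam * y)).le]
    · rw [indicator_of_notMem (by simpa using h1), zero_add]
      have : y ≤ y ^ ε⁻¹ := by
        simpa using Real.rpow_le_rpow_of_exponent_le h1 ((one_le_inv₀ hε.1).2 hε.2)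
      gcongr C * Real.exp ?_
      nlinarith [le_abs_self (y ^ ε⁻¹)]
  · refine Integrable.add ?_ ((integrableOn_exp_mul_Ioi (by linarith) 0).const_mul C)
    rw [integrable_indicator_iff measurableSet_Iio, IntegrableOn,
      Measure.restrict_restrict measurableSet_Iio, Iio_inter_Ioi]
    simp
  · have hne : ∀ᵐ y : ℝ ∂(volume.restrict (Ioi 0)), y ≠ 1 :=
      ae_restrict_of_ae (Measure.ae_ne volume 1)
    filter_upwards [ae_restrict_mem measurableSet_Ioi, hne] with y hy hy1
    have hy : 0 < y := hy
    rcases lt_or_gt_of_ne hy1 with h1 | h1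
    · rw [indicator_of_mem (show y ∈ Iio (1 : ℝ) from h1)]
      exact (hφ.tendsto 0).comp
        ((tendsto_rpow_atTop_of_base_lt_one y (by linarith) h1).comp tendsto_inv_nhdsGT_zero)
    · rw [indicator_of_notMem (by simpa using h1.le)]
      have hpow : Tendsto (fun ε : ℝ => |y ^ ε⁻¹|) (nhdsWithin 0 (Ioi 0)) atTop := by
        refine tendsto_abs_atTop_atTop.comp ?_
        simp_rw [Real.rpow_def_of_pos hy]
        exact Real.tendsto_exp_atTop.comp
          (tendsto_inv_nhdsGT_zero.const_mul_atTop (Real.log_pos h1))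
      have hexp : Tendsto (fun ε : ℝ => C * Real.exp (-lam * |y ^ ε⁻¹|))
          (nhdsWithin 0 (Ioi 0)) (nhds 0) := by
        simpa using (Real.tendsto_exp_atBot.comp
          (hpow.const_mul_atTop_of_neg (by linarith : -lam < 0))).const_mul C
      exact squeeze_zero_norm (fun ε => hb _) hexp

lemma integrableOn_Ioi_mul_abs_rpow_sub_one {lam C ε : ℝ} (hlam : 0 < lam) (hε : 0 < ε)
    {φ : ℝ → ℝ} (hφ : Continuous φ) (hb : ∀ x, |φ x| ≤ C * Real.exp (-lam * |x|)) :
    IntegrableOn (fun x => φ x * |x| ^ (ε - 1)) (Ioi 0) := by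
  refine Integrable.mono' ((integrableOn_rpow_mul_exp_neg_mul_rpow (s := ε - 1)
    (by linarith) one_pos hlam).const_mul C)
    (hφ.measurable.mul (by fun_prop)).aestronglyMeasurable ?_
  filter_upwards [ae_restrict_mem measurableSet_Ioi] with x hx
  have hx : 0 < x := hx
  have hp : 0 ≤ x ^ (ε - 1) := by positivity
  rw [Real.norm_eq_abs, abs_mul, abs_of_pos hx, abs_of_nonneg hp, Real.rpow_one]
  have := hb x
  rw [abs_of_pos hx] at this
  nlinarith [mul_le_mul_of_nonneg_right this hp]

/-- The measures `ε |x| ^ (ε - 1) dx` on `ℝ` converge to twice the Dirac mass at `0`. -/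
lemma tendsto_mul_integral_abs_rpow_sub_one {lam C : ℝ} (hlam : 0 < lam) {φ : ℝ → ℝ}
    (hφ : Continuous φ) (hb : ∀ x, |φ x| ≤ C * Real.exp (-lam * |x|)) :
    Tendsto (fun ε : ℝ => ε * ∫ x, φ x * |x| ^ (ε - 1))
      (nhdsWithin 0 (Ioi 0)) (nhds (2 * φ 0)) := by
  have hφ' : Continuous fun x => φ (-x) := by fun_prop
  have hb' : ∀ x, |φ (-x)| ≤ C * Real.exp (-lam * |x|) := fun x => by simpa using hb (-x)
  have hsum := (tendsto_mul_setIntegral_Ioi_rpow_sub_one hlam hφ hb).add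
    (tendsto_mul_setIntegral_Ioi_rpow_sub_one hlam hφ' hb')
  rw [neg_zero, ← two_mul] at hsum
  refine hsum.congr' (eventually_mem_nhdsWithin.mono fun ε hε => ?_)
  have hright := integrableOn_Ioi_mul_abs_rpow_sub_one hlam hε hφ hb
  have hleft : IntegrableOn (fun x => φ x * |x| ^ (ε - 1)) (Iic 0) := by
    have := integrableOn_Ioi_mul_abs_rpow_sub_one hlam hε hφ' hb'
    rw [integrableOn_Iic_iff_integrableOn_Iio]
    rw [← (Measure.measurePreserving_neg (volume : Measure ℝ)).integrableOn_comp_preimage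
      (Homeomorph.neg ℝ).measurableEmbedding]
    simpa [Function.comp_def] using this
  have hneg := integral_comp_neg_Ioi 0 (fun x => φ x * |x| ^ (ε - 1))
  simp only [abs_neg, neg_zero] at hneg
  rw [hneg, ← mul_add, add_comm, intervalIntegral.integral_Iic_add_Ioi hleft hright]

/-- For `λ > 0` and `K ∈ ℝ`,
`I(H) = H(2H−1) ∫₀^∞ ∫₀^∞ e^{−λu} e^{−λv} |u − v − K|^{2H−2} du dv` converges to
`e^{−λ|K|}/(2λ)` as `H → 1/2` from the right. -/
theorem stationary_rou_covariance_integral_tendsto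
    (lam K : ℝ) (hlam : 0 < lam) :
    Filter.Tendsto
      (fun H : ℝ =>
        H * (2 * H - 1) *
          ∫ p in Set.Ioi (0 : ℝ) ×ˢ Set.Ioi (0 : ℝ),
            Real.exp (-lam * p.1) * Real.exp (-lam * p.2) * |p.1 - p.2 - K| ^ (2 * H - 2))
      (nhdsWithin (1 / 2) (Set.Ioi (1 / 2 : ℝ)))
      (nhds (Real.exp (-lam * |K|) / (2 * lam))) := by
  have hbase : Tendsto (fun H : ℝ => 2 * H - 1) (nhdsWithin (1 / 2) (Ioi (1 / 2)))
      (nhdsWithin 0 (Ioi 0)) := by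
    refine tendsto_nhdsWithin_iff.2 ⟨tendsto_nhdsWithin_of_tendsto_nhds ?_,
      eventually_mem_nhdsWithin.mono fun H hH => ?_⟩
    · have : Continuous fun H : ℝ => 2 * H - 1 := by fun_prop
      simpa using this.tendsto (1 / 2)
    · simp only [mem_Ioi] at hH ⊢
      linarith
  have hφ : Continuous fun x : ℝ => Real.exp (-lam * |x + K|) / (2 * lam) := by fun_prop
  have hb : ∀ x : ℝ, |Real.exp (-lam * |x + K|) / (2 * lam)| ≤
      Real.exp (lam * |K|) / (2 * lam) * Real.exp (-lam * |x|) := by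
    intro x
    rw [abs_of_pos (by positivity), div_mul_eq_mul_div, ← Real.exp_add]
    gcongr
    have : |x| ≤ |x + K| + |K| := by simpa using abs_sub (x + K) K
    nlinarith
  have hid : Tendsto (fun H : ℝ => H) (nhdsWithin (1 / 2) (Ioi (1 / 2))) (nhds (1 / 2)) :=
    tendsto_nhdsWithin_of_tendsto_nhds tendsto_id
  have hlim := hid.mul ((tendsto_mul_integral_abs_rpow_sub_one hlam hφ hb).comp hbase)
  rw [zero_add, one_div, inv_mul_cancel_left₀ two_ne_zero, ← one_div] at hlim
  refine hlim.congr fun H => ?_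
  rw [setIntegral_exp_mul_exp_comp_sub hlam (h := fun x => |x - K| ^ (2 * H - 2))
    (by fun_prop) (fun x => by positivity), ← integral_add_right_eq_self _ K]
  simp only [Function.comp_apply, add_sub_cancel_right]
  rw [show 2 * H - 1 - 1 = 2 * H - 2 by ring]
  ring
end

section
/- Let λ > 0 and s, t ≥ 0. Then H(2H−1) ∫_{−∞}^{t} ∫_{−∞}^{s} e^{−λ(t−u)} e^{−λ(s−v)} |u − v|^{2H−2} dv du converges to e^{−λ|t−s|}/(2λ) as H → 1/2 from the right. -/
open MeasureTheory Set Filter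

/-- The substitution `z = w ^ ε` in `∫ w in (0, ∞), ε w ^ (ε - 1) φ w`. -/
lemma mul_integral_mul_rpow_sub_one (φ : ℝ → ℝ) {ε : ℝ} (hε : 0 < ε) :
    ε * ∫ w in Ioi 0, φ w * w ^ (ε - 1) = ∫ z in Ioi 0, φ (z ^ ε⁻¹) := by
  refine Eq.trans ?_ (integral_comp_rpow_Ioi_of_pos (g := fun z => φ (z ^ ε⁻¹)) hε)
  rw [← integral_const_mul]
  refine setIntegral_congr_fun measurableSet_Ioi fun w (hw : 0 < w) => ?_
  simp only [smul_eq_mul, Real.rpow_rpow_inv hw.le hε.ne']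
  ring

lemma integrableOn_indicator_add_exp_neg {μ : ℝ} (hμ : 0 < μ) :
    IntegrableOn (fun z : ℝ => (Iic 1).indicator 1 z + Real.exp (-μ * z)) (Ioi 0) := by
  refine IntegrableOn.add ?_ (exp_neg_integrableOn_Ioi 0 hμ)
  rw [IntegrableOn, integrable_indicator_iff measurableSet_Iic, IntegrableOn,
    Measure.restrict_restrict measurableSet_Iic, inter_comm, Ioi_inter_Iic]
  exact integrableOn_const (by simp)

lemma abs_comp_rpow_inv_le {φ : ℝ → ℝ} {C μ ε z : ℝ} (hμ : 0 < μ)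
    (hC : 0 ≤ C) (hφ : ∀ w, 0 < w → |φ w| ≤ C * Real.exp (-μ * w))
    (hε : 0 < ε) (hε1 : ε ≤ 1) (hz : 0 < z) :
    |φ (z ^ ε⁻¹)| ≤ C * ((Iic 1).indicator 1 z + Real.exp (-μ * z)) := by
  have hpos : 0 < z ^ ε⁻¹ := Real.rpow_pos_of_pos hz _
  refine (hφ _ hpos).trans (mul_le_mul_of_nonneg_left ?_ hC)
  rcases le_or_gt z 1 with h | h
  · have h1 : Real.exp (-μ * z ^ ε⁻¹) ≤ 1 := by
      rw [Real.exp_le_one_iff]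
      nlinarith
    have h2 := Real.exp_pos (-μ * z)
    simp only [indicator_of_mem (mem_Iic.2 h), Pi.one_apply]
    linarith
  · have h1 : z ≤ z ^ ε⁻¹ := Real.self_le_rpow_of_one_le h.le ((one_le_inv₀ hε).2 hε1)
    rw [indicator_of_notMem (by simpa using h), zero_add, Real.exp_le_exp]
    nlinarith

/-- Exponentially dominated functions are integrable against `w ^ (ε - 1)` on `(0, ∞)`. -/
lemma integrableOn_mul_rpow_sub_one {φ : ℝ → ℝ} {C μ ε : ℝ} (hmeas : Measurable φ) (hμ : 0 < μ)
    (hC : 0 ≤ C) (hφ : ∀ w, 0 < w → |φ w| ≤ C * Real.exp (-μ * w))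
    (hε : 0 < ε) (hε1 : ε ≤ 1) :
    IntegrableOn (fun w => φ w * w ^ (ε - 1)) (Ioi 0) := by
  have h : IntegrableOn (fun z => φ (z ^ ε⁻¹)) (Ioi 0) := by
    refine Integrable.mono' ((integrableOn_indicator_add_exp_neg hμ).const_mul C)
      (by fun_prop : Measurable fun z : ℝ => φ (z ^ ε⁻¹)).aestronglyMeasurable ?_
    filter_upwards [ae_restrict_mem measurableSet_Ioi] with z hz
    exact abs_comp_rpow_inv_le hμ hC hφ hε hε1 hz
  refine IntegrableOn.congr_fun ((integrableOn_Ioi_comp_rpow_iff' _ hε.ne').2 h)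
    (fun w (hw : 0 < w) => ?_) measurableSet_Ioi
  simp only [smul_eq_mul, Real.rpow_rpow_inv hw.le hε.ne']
  ring

lemma abs_mul_integral_mul_rpow_sub_one_le {φ : ℝ → ℝ} {C μ ε : ℝ} (hμ : 0 < μ)
    (hC : 0 ≤ C) (hφ : ∀ w, 0 < w → |φ w| ≤ C * Real.exp (-μ * w))
    (hε : 0 < ε) (hε1 : ε ≤ 1) :
    |ε * ∫ w in Ioi 0, φ w * w ^ (ε - 1)| ≤
      C * ∫ z in Ioi 0, ((Iic 1).indicator 1 z + Real.exp (-μ * z)) := by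
  rw [mul_integral_mul_rpow_sub_one φ hε, ← integral_const_mul]
  rw [← Real.norm_eq_abs]
  refine norm_integral_le_of_norm_le ((integrableOn_indicator_add_exp_neg hμ).const_mul C) ?_
  filter_upwards [ae_restrict_mem measurableSet_Ioi] with z hz
  exact abs_comp_rpow_inv_le hμ hC hφ hε hε1 hz

/-- As `ε → 0⁺`, the measures `ε w ^ (ε - 1) dw` on `(0, ∞)` concentrate at `0`. -/
lemma tendsto_mul_integral_mul_rpow_sub_one {φ : ℝ → ℝ} {C μ L : ℝ} (hmeas : Measurable φ)
    (hμ : 0 < μ) (hC : 0 ≤ C) (hφ : ∀ w, 0 < w → |φ w| ≤ C * Real.exp (-μ * w))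
    (hL : Tendsto φ (nhdsWithin 0 (Ioi 0)) (nhds L)) :
    Tendsto (fun ε : ℝ => ε * ∫ w in Ioi 0, φ w * w ^ (ε - 1))
      (nhdsWithin 0 (Ioi 0)) (nhds L) := by
  have hsmall : ∀ᶠ ε : ℝ in nhdsWithin 0 (Ioi 0), 0 < ε ∧ ε ≤ 1 := by
    filter_upwards [Ioc_mem_nhdsGT (zero_lt_one' ℝ)] with ε hε using hε
  have hlim : ∫ z in Ioi (0 : ℝ), (Iic 1).indicator (fun _ => L) z = L := by
    rw [setIntegral_indicator measurableSet_Iic, Ioi_inter_Iic]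
    simp
  suffices h : Tendsto (fun ε : ℝ => ∫ z in Ioi 0, φ (z ^ ε⁻¹)) (nhdsWithin 0 (Ioi 0))
      (nhds (∫ z in Ioi (0 : ℝ), (Iic 1).indicator (fun _ => L) z)) by
    rw [hlim] at h
    refine h.congr' ?_
    filter_upwards [hsmall] with ε hε using (mul_integral_mul_rpow_sub_one φ hε.1).symm
  refine tendsto_integral_filter_of_dominated_convergence
    (fun z => C * ((Iic 1).indicator 1 z + Real.exp (-μ * z)))
    (Eventually.of_forall fun ε =>
      (by fun_prop : Measurable fun z : ℝ => φ (z ^ ε⁻¹)).aestronglyMeasurable) ?_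
    ((integrableOn_indicator_add_exp_neg hμ).const_mul C) ?_
  · filter_upwards [hsmall] with ε hε
    filter_upwards [ae_restrict_mem measurableSet_Ioi] with z hz
    exact abs_comp_rpow_inv_le hμ hC hφ hε.1 hε.2 hz
  · have hne : ∀ᵐ z ∂(volume.restrict (Ioi (0 : ℝ))), z ≠ 1 :=
      ae_restrict_of_ae (Measure.ae_ne volume 1)
    filter_upwards [ae_restrict_mem measurableSet_Ioi, hne] with z (hz : 0 < z) hz1
    rcases lt_or_gt_of_ne hz1 with h | h
    · rw [indicator_of_mem (mem_Iic.2 h.le)]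
      refine hL.comp (tendsto_nhdsWithin_iff.2 ⟨?_, Eventually.of_forall fun ε =>
        Real.rpow_pos_of_pos hz _⟩)
      exact (tendsto_rpow_atTop_of_base_lt_one z (by linarith) h).comp tendsto_inv_nhdsGT_zero
    · rw [indicator_of_notMem (by simpa using h)]
      have htop : Tendsto (fun ε : ℝ => z ^ ε⁻¹) (nhdsWithin 0 (Ioi 0)) atTop := by
        have := (Real.tendsto_exp_atTop.comp
          (tendsto_id.const_mul_atTop (Real.log_pos h))).comp
          (tendsto_inv_nhdsGT_zero (𝕜 := ℝ))
        refine this.congr fun ε => ?_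
        simp [Real.rpow_def_of_pos hz]
      have hφ0 : Tendsto φ atTop (nhds 0) := by
        refine squeeze_zero_norm' (a := fun w => C * Real.exp (-μ * w)) ?_ ?_
        · filter_upwards [eventually_gt_atTop 0] with w hw using hφ w hw
        · have := (Real.tendsto_exp_atBot.comp
            (tendsto_id.const_mul_atTop_of_neg (neg_lt_zero.2 hμ))).const_mul C
          simpa using this
      exact hφ0.comp htop

/-- The causal exponential kernel `x ↦ e^{-λ x}` for `x ≥ 0`, and `0` for `x < 0`. -/
noncomputable def causalExp (lam : ℝ) : ℝ → ℝ := (Ici 0).indicator fun x => Real.exp (-lam * x)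

@[fun_prop]
lemma measurable_causalExp (lam : ℝ) : Measurable (causalExp lam) :=
  Measurable.indicator (by fun_prop) measurableSet_Ici

lemma abs_causalExp_le {lam μ : ℝ} (h : |μ| ≤ lam) (x : ℝ) :
    |causalExp lam x| ≤ Real.exp (μ * x) := by
  by_cases hx : 0 ≤ x
  · rw [causalExp, indicator_of_mem (mem_Ici.2 hx), abs_of_pos (Real.exp_pos _), Real.exp_le_exp]
    nlinarith [(abs_le.1 h).1]
  · rw [causalExp, indicator_of_notMem (by simpa using hx), abs_zero]
    positivity

lemma continuousAt_causalExp (lam : ℝ) {a : ℝ} (ha : a ≠ 0) : ContinuousAt (causalExp lam) a := by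
  rcases lt_or_gt_of_ne ha with h | h
  · refine (continuousAt_const (y := (0 : ℝ))).congr ?_
    filter_upwards [Iio_mem_nhds h] with x hx
    rw [causalExp, indicator_of_notMem (by simpa using hx)]
  · refine (Continuous.continuousAt (f := fun x => Real.exp (-lam * x)) (by fun_prop)).congr ?_
    filter_upwards [Ioi_mem_nhds h] with x (hx : 0 < x)
    rw [causalExp, indicator_of_mem (mem_Ici.2 hx.le)]

lemma abs_causalExp_sub_le {lam : ℝ} (hlam : 0 < lam) (a w : ℝ) :
    |causalExp lam (a - w)| ≤ Real.exp (lam / 2 * a) * Real.exp (-(lam / 2) * w) := by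
  rw [← Real.exp_add]
  refine (abs_causalExp_le (μ := lam / 2) (by rw [abs_of_pos] <;> linarith) (a - w)).trans_eq ?_
  ring_nf

lemma abs_causalExp_add_le {lam : ℝ} (hlam : 0 < lam) (a w : ℝ) :
    |causalExp lam (a + w)| ≤ Real.exp (-(lam / 2) * a) * Real.exp (-(lam / 2) * w) := by
  rw [← Real.exp_add]
  refine (abs_causalExp_le (μ := -(lam / 2))
    (by rw [abs_neg, abs_of_pos] <;> linarith) (a + w)).trans_eq ?_
  ring_nf

/-- The convolution of the causal exponential kernel with `|·| ^ (ε - 1)`, split at the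
singularity. -/
lemma integral_Iic_exp_mul_abs_rpow {lam ε : ℝ} (hlam : 0 < lam) (hε : 0 < ε) (hε1 : ε ≤ 1)
    (s u : ℝ) :
    ∫ v in Iic s, Real.exp (-lam * (s - v)) * |u - v| ^ (ε - 1) =
      (∫ w in Ioi 0, causalExp lam (s - u + w) * w ^ (ε - 1)) +
        ∫ w in Ioi 0, causalExp lam (s - u - w) * w ^ (ε - 1) := by
  have hμ : 0 < lam / 2 := by positivity
  have hplus := integrableOn_mul_rpow_sub_one (φ := fun w => causalExp lam (s - u + w))
    (by fun_prop) hμ (Real.exp_pos _).le (fun w _ => abs_causalExp_add_le hlam (s - u) w) hε hε1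
  have hminus := integrableOn_mul_rpow_sub_one (φ := fun w => causalExp lam (s - u - w))
    (by fun_prop) hμ (Real.exp_pos _).le (fun w _ => abs_causalExp_sub_le hlam (s - u) w) hε hε1
  set g : ℝ → ℝ := fun w => causalExp lam (s - u - w) * |w| ^ (ε - 1) with hg
  have hIoi : EqOn (fun w => causalExp lam (s - u - w) * w ^ (ε - 1)) g (Ioi 0) :=
    fun w (hw : 0 < w) => by simp only [hg, abs_of_pos hw]
  have hIoi' : EqOn (fun w => causalExp lam (s - u + w) * w ^ (ε - 1)) (fun w => g (-w)) (Ioi 0) :=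
    fun w (hw : 0 < w) => by simp only [hg, abs_neg, abs_of_pos hw, sub_neg_eq_add]
  have hgr : IntegrableOn g (Ioi 0) := hminus.congr_fun hIoi measurableSet_Ioi
  have hgl : IntegrableOn g (Iic 0) := by
    have h := (hplus.congr_fun hIoi' measurableSet_Ioi)
    have h' := IntegrableOn.comp_neg_Iio (c := 0) (f := fun w => g (-w)) (by simpa using h)
    rw [integrableOn_Iic_iff_integrableOn_Iio]
    simpa using h'
  calc ∫ v in Iic s, Real.exp (-lam * (s - v)) * |u - v| ^ (ε - 1)
      = ∫ v, g (v - u) := by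
        rw [← integral_indicator measurableSet_Iic]
        congr 1
        ext v
        by_cases hv : v ≤ s
        · rw [indicator_of_mem (mem_Iic.2 hv)]
          simp [hg, causalExp, hv, abs_sub_comm u v]
        · rw [indicator_of_notMem (by simpa using hv)]
          simp [hg, causalExp, hv]
    _ = ∫ w, g w := integral_sub_right_eq_self g u
    _ = (∫ w in Iic 0, g w) + ∫ w in Ioi 0, g w :=
        (intervalIntegral.integral_Iic_add_Ioi hgl hgr).symm
    _ = _ := by
        rw [setIntegral_congr_fun measurableSet_Ioi hIoi,
          setIntegral_congr_fun measurableSet_Ioi hIoi', integral_comp_neg_Ioi, neg_zero]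

lemma abs_mul_integral_Iic_exp_mul_abs_rpow_le {lam ε : ℝ} (hlam : 0 < lam) (hε : 0 < ε)
    (hε1 : ε ≤ 1) (s u : ℝ) :
    |ε * ∫ v in Iic s, Real.exp (-lam * (s - v)) * |u - v| ^ (ε - 1)| ≤
      (Real.exp (-(lam / 2) * (s - u)) + Real.exp (lam / 2 * (s - u))) *
        ∫ z in Ioi 0, ((Iic 1).indicator 1 z + Real.exp (-(lam / 2) * z)) := by
  have hμ : 0 < lam / 2 := by positivity
  rw [integral_Iic_exp_mul_abs_rpow hlam hε hε1, mul_add, add_mul]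
  exact (abs_add_le _ _).trans (add_le_add
    (abs_mul_integral_mul_rpow_sub_one_le hμ (Real.exp_pos _).le
      (fun w _ => abs_causalExp_add_le hlam (s - u) w) hε hε1)
    (abs_mul_integral_mul_rpow_sub_one_le hμ (Real.exp_pos _).le
      (fun w _ => abs_causalExp_sub_le hlam (s - u) w) hε hε1))

lemma tendsto_mul_integral_Iic_exp_mul_abs_rpow {lam s u : ℝ} (hlam : 0 < lam) (hu : u ≠ s) :
    Tendsto (fun ε : ℝ => ε * ∫ v in Iic s, Real.exp (-lam * (s - v)) * |u - v| ^ (ε - 1))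
      (nhdsWithin 0 (Ioi 0)) (nhds (2 * causalExp lam (s - u))) := by
  have hμ : 0 < lam / 2 := by positivity
  have hcont := continuousAt_causalExp lam (sub_ne_zero.2 hu.symm)
  have hplus := tendsto_mul_integral_mul_rpow_sub_one (L := causalExp lam (s - u))
    (φ := fun w => causalExp lam (s - u + w)) (by fun_prop) hμ (Real.exp_pos _).le
    (fun w _ => abs_causalExp_add_le hlam (s - u) w)
    (hcont.tendsto.comp (tendsto_nhdsWithin_of_tendsto_nhds
      (Continuous.tendsto' (by fun_prop) _ _ (by simp))))
  have hminus := tendsto_mul_integral_mul_rpow_sub_one (L := causalExp lam (s - u))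
    (φ := fun w => causalExp lam (s - u - w)) (by fun_prop) hμ (Real.exp_pos _).le
    (fun w _ => abs_causalExp_sub_le hlam (s - u) w)
    (hcont.tendsto.comp (tendsto_nhdsWithin_of_tendsto_nhds
      (Continuous.tendsto' (by fun_prop) _ _ (by simp))))
  rw [two_mul]
  refine (hplus.add hminus).congr' ?_
  filter_upwards [Ioc_mem_nhdsGT (zero_lt_one' ℝ)] with ε hε
  rw [integral_Iic_exp_mul_abs_rpow hlam hε.1 hε.2, mul_add]

/-- The covariance of the stationary Gaussian Ornstein–Uhlenbeck process. -/
lemma integral_Iic_exp_mul_causalExp {lam : ℝ} (hlam : 0 < lam) (s t : ℝ) :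
    ∫ u in Iic t, Real.exp (-lam * (t - u)) * causalExp lam (s - u) =
      Real.exp (-lam * |t - s|) / (2 * lam) := by
  have h : ∀ u, Real.exp (-lam * (t - u)) * causalExp lam (s - u) =
      (Iic s).indicator (fun u => Real.exp (-lam * (t + s)) * Real.exp (2 * lam * u)) u := by
    intro u
    by_cases hu : u ≤ s
    · simp only [causalExp, indicator_of_mem (mem_Iic.2 hu),
        indicator_of_mem (mem_Ici.2 (sub_nonneg.2 hu)), ← Real.exp_add]
      ring_nf
    · simp [causalExp, hu]
  simp_rw [h]
  rw [setIntegral_indicator measurableSet_Iic, Iic_inter_Iic, integral_const_mul,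
    integral_exp_mul_Iic (by positivity), mul_div_assoc', ← Real.exp_add]
  congr 2
  rcases le_total t s with hts | hts
  · rw [min_eq_left hts, abs_of_nonpos (by linarith)]
    ring
  · rw [min_eq_right hts, abs_of_nonneg (by linarith)]
    ring

lemma tendsto_mul_integral_integral_exp_mul_abs_rpow {lam : ℝ} (hlam : 0 < lam) (s t : ℝ) :
    Tendsto (fun ε : ℝ => ε * ∫ u in Iic t, ∫ v in Iic s,
        Real.exp (-lam * (t - u)) * Real.exp (-lam * (s - v)) * |u - v| ^ (ε - 1))
      (nhdsWithin 0 (Ioi 0)) (nhds (2 * (Real.exp (-lam * |t - s|) / (2 * lam)))) := by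
  rw [← integral_Iic_exp_mul_causalExp hlam, ← integral_const_mul]
  have hout : ∀ ε : ℝ, ε * ∫ u in Iic t, ∫ v in Iic s,
      Real.exp (-lam * (t - u)) * Real.exp (-lam * (s - v)) * |u - v| ^ (ε - 1) =
      ∫ u in Iic t, Real.exp (-lam * (t - u)) *
        (ε * ∫ v in Iic s, Real.exp (-lam * (s - v)) * |u - v| ^ (ε - 1)) := by
    intro ε
    rw [← integral_const_mul]
    congr 1
    ext u
    simp_rw [mul_assoc (Real.exp _) (Real.exp _), integral_const_mul]
    exact mul_left_comm _ _ _
  simp_rw [hout]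
  set D := ∫ z in Ioi (0 : ℝ), ((Iic 1).indicator 1 z + Real.exp (-(lam / 2) * z))
  have hexp : ∀ (c : ℝ), 0 < lam + c → IntegrableOn (fun u =>
      Real.exp (-lam * (t - u)) * (Real.exp (-c * (s - u)) * D)) (Iic t) := by
    intro c hc
    refine IntegrableOn.congr_fun ((integrableOn_exp_mul_Iic hc t).const_mul
      (Real.exp (-lam * t - c * s) * D)) (fun u _ => ?_) measurableSet_Iic
    have : Real.exp (-lam * t - c * s) * Real.exp ((lam + c) * u) =
        Real.exp (-lam * (t - u)) * Real.exp (-c * (s - u)) := by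
      rw [← Real.exp_add, ← Real.exp_add]
      ring_nf
    linear_combination D * this
  refine tendsto_integral_filter_of_dominated_convergence
    (fun u => Real.exp (-lam * (t - u)) *
      ((Real.exp (-(lam / 2) * (s - u)) + Real.exp (lam / 2 * (s - u))) * D)) ?_ ?_ ?_ ?_
  · refine Eventually.of_forall fun ε => ?_
    refine Measurable.aestronglyMeasurable ?_
    refine Measurable.mul (by fun_prop) (Measurable.const_mul ?_ ε)
    exact (StronglyMeasurable.integral_prod_right (ν := volume.restrict (Iic s))
      (f := fun u v : ℝ => Real.exp (-lam * (s - v)) * |u - v| ^ (ε - 1))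
      (Measurable.stronglyMeasurable (by fun_prop))).measurable
  · filter_upwards [Ioc_mem_nhdsGT (zero_lt_one' ℝ)] with ε hε
    refine Eventually.of_forall fun u => ?_
    rw [Real.norm_eq_abs, abs_mul, abs_of_pos (Real.exp_pos _)]
    exact mul_le_mul_of_nonneg_left
      (abs_mul_integral_Iic_exp_mul_abs_rpow_le hlam hε.1 hε.2 s u) (Real.exp_pos _).le
  · refine ((hexp (lam / 2) (by positivity)).add (hexp (-(lam / 2)) (by linarith))).congr_fun
      (fun u _ => ?_) measurableSet_Iic
    simp only [Pi.add_apply, neg_neg]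
    ring
  · filter_upwards [ae_restrict_of_ae (Measure.ae_ne volume s)] with u hu
    have := (tendsto_mul_integral_Iic_exp_mul_abs_rpow hlam hu).const_mul
      (Real.exp (-lam * (t - u)))
    rwa [mul_left_comm] at this

/-- For `λ > 0` and `s, t ≥ 0`,
`H(2H−1) ∫_{−∞}^t ∫_{−∞}^s e^{−λ(t−u)} e^{−λ(s−v)} |u − v|^{2H−2} dv du` converges to
`e^{−λ|t−s|}/(2λ)` as `H → 1/2` from the right. -/
theorem stationary_rou_covariance_tendsto
    (lam s t : ℝ) (hlam : 0 < lam) (hs : 0 ≤ s) (ht : 0 ≤ t) :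
    Filter.Tendsto
      (fun H : ℝ =>
        H * (2 * H - 1) *
          ∫ u in Set.Iic t, ∫ v in Set.Iic s,
            Real.exp (-lam * (t - u)) * Real.exp (-lam * (s - v)) * |u - v| ^ (2 * H - 2))
      (nhdsWithin (1 / 2) (Set.Ioi (1 / 2 : ℝ)))
      (nhds (Real.exp (-lam * |t - s|) / (2 * lam))) := by
  have hε : Tendsto (fun H : ℝ => 2 * H - 1) (nhdsWithin (1 / 2) (Ioi (1 / 2 : ℝ)))
      (nhdsWithin 0 (Ioi 0)) := by
    refine tendsto_nhdsWithin_iff.2 ⟨tendsto_nhdsWithin_of_tendsto_nhds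
      (Continuous.tendsto' (by fun_prop) _ _ (by norm_num)), ?_⟩
    filter_upwards [self_mem_nhdsWithin] with H (hH : 1 / 2 < H)
    simp only [mem_Ioi]
    linarith
  have hH : Tendsto (fun H : ℝ => H) (nhdsWithin (1 / 2) (Ioi (1 / 2 : ℝ))) (nhds (1 / 2)) :=
    tendsto_nhdsWithin_of_tendsto_nhds tendsto_id
  convert hH.mul ((tendsto_mul_integral_integral_exp_mul_abs_rpow hlam s t).comp hε) using 2
  · simp only [Function.comp_apply, mul_assoc]
    ring_nf
  · ring
end

section
/- Let λ > 0, H ∈ (1/4, 1), and c₁, c₂, c₃, c₄ ∈ ℝ with c₁ + c₂ + c₃ + c₄ = 0. Then ∫_{(0,∞)⁴} e^{−λ(u₁+u₂+u₃+u₄)} |u₁−u₂−c₁|^{H−1} |u₂−u₃−c₂|^{H−1} |u₃−u₄−c₃|^{H−1} |u₄−u₁−c₄|^{H−1} du₁ du₂ du₃ du₄ < ∞. -/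
open MeasureTheory ENNReal Set

lemma lmarginal_insert_mul_le {δ : Type*} [DecidableEq δ] {X : δ → Type*}
    [∀ i, MeasurableSpace (X i)] (μ : ∀ i, Measure (X i)) [∀ i, SigmaFinite (μ i)]
    {s : Finset δ} {i : δ} (hi : i ∉ s) {g k : (∀ i, X i) → ℝ≥0∞} (hg : Measurable g)
    (hk : Measurable k) (hgi : ∀ x t, g (Function.update x i t) = g x) {K : ℝ≥0∞}
    (hK : ∀ x, ∫⁻ t, k (Function.update x i t) ∂μ i ≤ K) (x : ∀ i, X i) :
    lmarginal μ (insert i s) (fun u => k u * g u) x ≤ K * lmarginal μ s g x := by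
  rw [lmarginal_insert' (fun u => k u * g u) (hk.mul hg) hi, lmarginal, lmarginal,
    ← lintegral_const_mul K (f := fun y => g (Function.updateFinset x s y))
      (hg.comp measurable_updateFinset)]
  refine lintegral_mono fun y => ?_
  simp only [hgi]
  rw [lintegral_mul_const _ (f := fun t => k (Function.update _ i t))
    (hk.comp (measurable_update _))]
  gcongr
  exact hK _

/-- Shifted singular powers `|t - y| ^ β` with `β > -1` are integrable against an exponential
weight, uniformly in the shift. -/
lemma exists_lintegral_exp_mul_abs_sub_rpow_le {lam β : ℝ} (hlam : 0 < lam) (hβ : -1 < β)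
    (hβ' : β ≤ 0) :
    ∃ K : ℝ≥0∞, K < ⊤ ∧ ∀ y : ℝ, ∫⁻ t in Ioi 0,
      ENNReal.ofReal (Real.exp (-lam * t)) * ENNReal.ofReal (|t - y| ^ β) ≤ K := by
  let φ : ℝ → ℝ≥0∞ := (Icc (-1) 1).indicator fun x => ENNReal.ofReal (|x| ^ β)
  have hφ : Measurable φ := Measurable.indicator (by fun_prop) measurableSet_Icc
  have hφ_int : ∫⁻ x, φ x < ⊤ := by
    have h : LocallyIntegrable (fun x : ℝ => |x| ^ β) :=
      locallyIntegrable_of_norm_le_rpow (C := 1) (α := -β) (by simp)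
        (by simpa using by linarith)
        (Filter.Eventually.of_forall fun x => by
          simp [abs_of_nonneg (Real.rpow_nonneg (abs_nonneg x) β)])
        (by fun_prop : Measurable fun x : ℝ => |x| ^ β).aestronglyMeasurable
    rw [lintegral_indicator measurableSet_Icc]
    exact (h.integrableOn_isCompact isCompact_Icc).lintegral_lt_top
  have hexp : ∫⁻ t in Ioi 0, ENNReal.ofReal (Real.exp (-lam * t)) < ⊤ :=
    (exp_neg_integrableOn_Ioi 0 hlam).lintegral_lt_top
  refine ⟨_, ENNReal.add_lt_top.2 ⟨hφ_int, hexp⟩, fun y => ?_⟩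
  calc
    _ ≤ ∫⁻ t in Ioi 0, (φ (t - y) + ENNReal.ofReal (Real.exp (-lam * t))) := by
      refine setLIntegral_mono (by fun_prop) fun t ht => ?_
      by_cases hty : t - y ∈ Icc (-1 : ℝ) 1
      · have h1 : ENNReal.ofReal (Real.exp (-lam * t)) ≤ 1 := by
          rw [ENNReal.ofReal_le_one, Real.exp_le_one_iff]
          nlinarith [mem_Ioi.1 ht]
        simp only [φ, indicator_of_mem hty]
        exact (mul_le_of_le_one_left' h1).trans le_self_add
      · have h1 : ENNReal.ofReal (|t - y| ^ β) ≤ 1 := by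
          rw [ENNReal.ofReal_le_one]
          refine Real.rpow_le_one_of_one_le_of_nonpos ?_ hβ'
          rw [mem_Icc, ← abs_le, not_le] at hty
          exact hty.le
        exact (mul_le_of_le_one_right' h1).trans le_add_self
    _ = (∫⁻ t in Ioi 0, φ (t - y)) + ∫⁻ t in Ioi 0, ENNReal.ofReal (Real.exp (-lam * t)) :=
      lintegral_add_left (by fun_prop) _
    _ ≤ (∫⁻ t, φ (t - y)) + ∫⁻ t in Ioi 0, ENNReal.ofReal (Real.exp (-lam * t)) := by
      gcongr
      exact Measure.restrict_le_self
    _ = _ := by rw [lintegral_sub_right_eq_self]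

lemma prod_pow_three_le_sum_pow_four (r : Fin 4 → ℝ) :
    ∏ i, r i ^ 3 ≤ ∑ j, (r (j + 1) * r (j + 2) * r (j + 3)) ^ 4 := by
  have amgm (x y z w : ℝ) : x * y * z * w ≤ x ^ 4 + y ^ 4 + z ^ 4 + w ^ 4 := by
    nlinarith [sq_nonneg (x * y - z * w), sq_nonneg (x ^ 2 - y ^ 2), sq_nonneg (z ^ 2 - w ^ 2),
      sq_nonneg (x ^ 2), sq_nonneg (y ^ 2), sq_nonneg (z ^ 2), sq_nonneg (w ^ 2)]
  calc
    ∏ i, r i ^ 3 = (r 1 * r 2 * r 3) * (r 2 * r 3 * r 0) * (r 3 * r 0 * r 1) *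
        (r 0 * r 1 * r 2) := by
      rw [Fin.prod_univ_four]
      ring
    _ ≤ _ := amgm _ _ _ _
    _ = _ := by
      rw [Fin.sum_univ_four]
      rfl

lemma lintegral_exp_mul_cyclic_path_lt_top {lam β : ℝ} (hlam : 0 < lam) (hβ : -1 < β)
    (hβ' : β ≤ 0) (c : Fin 4 → ℝ) (j : Fin 4) :
    ∫⁻ u : Fin 4 → ℝ, (∏ i, ENNReal.ofReal (Real.exp (-lam * u i))) *
        (ENNReal.ofReal (|u (j + 1) - u (j + 1 + 1) - c (j + 1)| ^ β) *
          ENNReal.ofReal (|u (j + 2) - u (j + 2 + 1) - c (j + 2)| ^ β) *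
          ENNReal.ofReal (|u (j + 3) - u (j + 3 + 1) - c (j + 3)| ^ β))
      ∂Measure.pi (fun _ => volume.restrict (Ioi 0)) < ⊤ := by
  obtain ⟨K, hK, hle⟩ := exists_lintegral_exp_mul_abs_sub_rpow_le hlam hβ hβ'
  let μ : Fin 4 → Measure ℝ := fun _ => volume.restrict (Ioi 0)
  let e : Fin 4 → (Fin 4 → ℝ) → ℝ≥0∞ := fun i u => ENNReal.ofReal (Real.exp (-lam * u i))
  let q : Fin 4 → (Fin 4 → ℝ) → ℝ≥0∞ := fun i u =>
    e i u * ENNReal.ofReal (|u i - u (i + 1) - c i| ^ β)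
  have he (i) : Measurable (e i) := by fun_prop
  have hq (i) : Measurable (q i) := by fun_prop
  have hqK (i x) : ∫⁻ t, q i (Function.update x i t) ∂μ i ≤ K := by
    have hne : i + 1 ≠ i := by simp
    simpa [q, e, μ, Function.update_of_ne hne, sub_sub] using hle (x (i + 1) + c i)
  have heK : ∫⁻ t in Ioi 0, ENNReal.ofReal (Real.exp (-lam * t)) < ⊤ :=
    (exp_neg_integrableOn_Ioi 0 hlam).lintegral_lt_top
  have he_upd {i k : Fin 4} (h : k ≠ i) (x t) : e k (Function.update x i t) = e k x := by
    simp [e, Function.update_of_ne h]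
  have hq_upd {i k : Fin 4} (h : k ≠ i) (h' : k + 1 ≠ i) (x t) :
      q k (Function.update x i t) = q k x := by
    simp [q, he_upd h, Function.update_of_ne h, Function.update_of_ne h']
  have huniv (j : Fin 4) : (Finset.univ : Finset (Fin 4)) =
      insert (j + 1) (insert (j + 2) (insert (j + 3) {j})) := by
    revert j; decide
  have hprod (j) (u : Fin 4 → ℝ) : ∏ i, e i u = e (j + 1) u * e (j + 2) u * e (j + 3) u * e j u := by
    fin_cases j <;> simp [Fin.prod_univ_four] <;> ring
  calc
    _ = ∫⁻ u, q (j + 1) u * (q (j + 2) u * (q (j + 3) u * e j u)) ∂Measure.pi μ := by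
      refine lintegral_congr fun u => ?_
      change (∏ i, e i u) * _ = _
      rw [hprod j]
      simp only [q]
      ring
    _ = lmarginal μ (insert (j + 1) (insert (j + 2) (insert (j + 3) {j})))
        (fun u => q (j + 1) u * (q (j + 2) u * (q (j + 3) u * e j u))) 0 := by
      rw [lintegral_eq_lmarginal_univ 0, huniv j]
    _ ≤ K * lmarginal μ (insert (j + 2) (insert (j + 3) {j}))
        (fun u => q (j + 2) u * (q (j + 3) u * e j u)) 0 :=
      lmarginal_insert_mul_le μ (by revert j; decide) (by fun_prop) (hq _) (fun x t => by
        rw [hq_upd, hq_upd, he_upd] <;> revert j <;> decide) (hqK _) 0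
    _ ≤ K * (K * lmarginal μ (insert (j + 3) {j}) (fun u => q (j + 3) u * e j u) 0) := by
      gcongr
      exact lmarginal_insert_mul_le μ (by revert j; decide) (by fun_prop) (hq _) (fun x t => by
        rw [hq_upd, he_upd] <;> revert j <;> decide) (hqK _) 0
    _ ≤ K * (K * (K * lmarginal μ {j} (e j) 0)) := by
      gcongr
      exact lmarginal_insert_mul_le μ (by revert j; decide) (he _) (hq _) (fun x t => by
        rw [he_upd]; revert j; decide) (hqK _) 0
    _ < ⊤ := by
      rw [lmarginal_singleton]
      simp only [e, Function.update_self, μ]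
      exact ENNReal.mul_lt_top hK (ENNReal.mul_lt_top hK (ENNReal.mul_lt_top hK heK))

/-- For `λ > 0`, `H ∈ (1/4, 1)` and `c₁ + c₂ + c₃ + c₄ = 0`, the four-fold integral
`∫_{(0,∞)⁴} e^{−λ(u₁+⋯+u₄)} ∏_{cyclic} |u_i − u_{i+1} − c_i|^{H−1} du` is finite. -/
theorem stationary_fourth_cumulant_integral_finite
    (lam H : ℝ) (hlam : 0 < lam) (hH : H ∈ Set.Ioo (1 / 4 : ℝ) 1)
    (c : Fin 4 → ℝ) (hc : ∑ i : Fin 4, c i = 0) :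
    (∫⁻ u in Set.pi Set.univ (fun _ : Fin 4 => Set.Ioi (0 : ℝ)),
        ENNReal.ofReal
          (Real.exp (-lam * ∑ i : Fin 4, u i) *
            ∏ i : Fin 4, |u i - u (i + 1) - c i| ^ (H - 1))) < ⊤ := by
  obtain ⟨hH₁, hH₂⟩ := hH
  have hpow {w : ℝ} (hw : 0 ≤ w) (n : ℕ) : (w ^ ((H - 1) / 3)) ^ n = w ^ (n * (H - 1) / 3) := by
    rw [← Real.rpow_mul_natCast hw]
    ring_nf
  have hpt (u : Fin 4 → ℝ) :
      ENNReal.ofReal (Real.exp (-lam * ∑ i : Fin 4, u i) *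
          ∏ i : Fin 4, |u i - u (i + 1) - c i| ^ (H - 1)) ≤
        ∑ j : Fin 4, (∏ i, ENNReal.ofReal (Real.exp (-lam * u i))) *
          (ENNReal.ofReal (|u (j + 1) - u (j + 1 + 1) - c (j + 1)| ^ (4 * (H - 1) / 3)) *
            ENNReal.ofReal (|u (j + 2) - u (j + 2 + 1) - c (j + 2)| ^ (4 * (H - 1) / 3)) *
            ENNReal.ofReal (|u (j + 3) - u (j + 3 + 1) - c (j + 3)| ^ (4 * (H - 1) / 3))) := by
    have h := prod_pow_three_le_sum_pow_four fun i => |u i - u (i + 1) - c i| ^ ((H - 1) / 3)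
    simp only [mul_pow, hpow (abs_nonneg _), Nat.cast_ofNat,
      mul_div_cancel_left₀ (H - 1) (three_ne_zero : (3 : ℝ) ≠ 0)] at h
    rw [← Finset.mul_sum, ← ENNReal.ofReal_prod_of_nonneg fun _ _ => (Real.exp_pos _).le,
      ← Real.exp_sum, ← Finset.mul_sum, ENNReal.ofReal_mul (Real.exp_pos _).le]
    gcongr
    refine (ENNReal.ofReal_le_ofReal h).trans_eq ?_
    rw [ENNReal.ofReal_sum_of_nonneg fun _ _ => by positivity]
    refine Finset.sum_congr rfl fun j _ => ?_
    rw [ENNReal.ofReal_mul (by positivity), ENNReal.ofReal_mul (by positivity)]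
  rw [volume_pi, Measure.restrict_pi_pi]
  refine (lintegral_mono hpt).trans_lt ?_
  rw [lintegral_finsetSum _ fun j _ => by fun_prop]
  exact ENNReal.sum_lt_top.2 fun j _ =>
    lintegral_exp_mul_cyclic_path_lt_top hlam (by linarith) (by linarith) c j
end

section
/- Let λ > 0 and c₁, c₂, c₃, c₄ ∈ ℝ with c₁ + c₂ + c₃ + c₄ = 0. Then (2H−1)² ∫_{(0,∞)⁴} e^{−λ(u₁+u₂+u₃+u₄)} |u₁−u₂−c₁|^{H−1} |u₂−u₃−c₂|^{H−1} |u₃−u₄−c₃|^{H−1} |u₄−u₁−c₄|^{H−1} du₁ du₂ du₃ du₄ converges to 0 as H → 1/2 from the right. -/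
open MeasureTheory Set Filter

/-- In a product of four nonnegative factors, the smallest one is controlled by the geometric mean
of the other three. -/
lemma prod_pow_three_le_sum_prod_succAbove_pow_four (y : Fin 4 → ℝ) (hy : ∀ i, 0 ≤ y i) :
    ∏ i, y i ^ 3 ≤ ∑ j : Fin 4, ∏ i : Fin 3, y (j.succAbove i) ^ 4 := by
  obtain ⟨j, hj⟩ := Finite.exists_min y
  refine le_trans ?_ (Finset.single_le_sum
    (f := fun j : Fin 4 => ∏ i : Fin 3, y (j.succAbove i) ^ 4)
    (fun j _ => Finset.prod_nonneg fun i _ => pow_nonneg (hy _) 4) (Finset.mem_univ j))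
  rw [Fin.prod_univ_succAbove _ j]
  have hmin : y j ^ 3 ≤ ∏ i : Fin 3, y (j.succAbove i) := by
    simpa using Finset.prod_le_prod (s := (Finset.univ : Finset (Fin 3)))
      (fun _ _ => hy j) (fun i _ => hj (j.succAbove i))
  calc y j ^ 3 * ∏ i : Fin 3, y (j.succAbove i) ^ 3
      ≤ (∏ i : Fin 3, y (j.succAbove i)) * ∏ i : Fin 3, y (j.succAbove i) ^ 3 :=
        mul_le_mul_of_nonneg_right hmin
          (Finset.prod_nonneg fun i _ => pow_nonneg (hy _) 3)
    _ = ∏ i : Fin 3, y (j.succAbove i) ^ 4 := by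
        rw [← Finset.prod_mul_distrib]
        exact Finset.prod_congr rfl fun i _ => by ring

/-- Integrating a product of kernels along a path, one endpoint at a time. -/
lemma lintegral_path_le {α : Type*} [MeasurableSpace α] (μ : Measure α) [SigmaFinite μ]
    (w : α → ENNReal) (hw : Measurable w) (K : ENNReal) (n : ℕ)
    (h : Fin n → α → α → ENNReal) (hm : ∀ i, Measurable (Function.uncurry (h i)))
    (hK : ∀ i y, ∫⁻ x, h i x y ∂μ ≤ K) :
    ∫⁻ u : Fin (n + 1) → α, w (u (Fin.last n)) * ∏ i : Fin n, h i (u i.castSucc) (u i.succ)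
        ∂(Measure.pi fun _ => μ) ≤ K ^ n * ∫⁻ x, w x ∂μ := by
  induction n with
  | zero =>
    have := (measurePreserving_piUnique (fun _ : Fin 1 => μ)).lintegral_comp hw
    simp only [Finset.univ_eq_empty, Finset.prod_empty, mul_one, pow_zero, one_mul]
    exact this.le
  | succ n ih =>
    let F : (Fin (n + 1) → α) → ENNReal := fun v =>
      w (v (Fin.last n)) * ∏ i : Fin n, h i.succ (v i.castSucc) (v i.succ)
    have hF : Measurable F := by
      refine (hw.comp (measurable_pi_apply _)).mul (Finset.measurable_prod _ fun i _ => ?_)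
      have hpair : Measurable fun v : Fin (n + 1) → α => (v i.castSucc, v i.succ) := by fun_prop
      exact (hm i.succ).comp hpair
    have hG : Measurable fun p : α × (Fin (n + 1) → α) => h 0 p.1 (p.2 0) * F p.2 :=
      ((hm 0).comp (measurable_fst.prodMk ((measurable_pi_apply _).comp measurable_snd))).mul
        (hF.comp measurable_snd)
    have key := (measurePreserving_piFinSuccAbove (fun _ : Fin (n + 2) => μ) 0).lintegral_comp hG
    calc _ = ∫⁻ p : α × (Fin (n + 1) → α), h 0 p.1 (p.2 0) * F p.2
              ∂(μ.prod (Measure.pi fun _ => μ)) := by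
          rw [← key]
          refine lintegral_congr fun u => ?_
          simp only [F, MeasurableEquiv.piFinSuccAbove_apply, Fin.prod_univ_succ (n := n)]
          simp [Fin.insertNthEquiv, Fin.tail, mul_left_comm]
      _ = ∫⁻ v : Fin (n + 1) → α, (∫⁻ x, h 0 x (v 0) ∂μ) * F v ∂(Measure.pi fun _ => μ) := by
          rw [lintegral_prod_symm _ hG.aemeasurable]
          refine lintegral_congr fun v => ?_
          exact lintegral_mul_const (F v) ((hm 0).comp (measurable_id.prodMk (measurable_const (a := v 0))))
      _ ≤ ∫⁻ v : Fin (n + 1) → α, K * F v ∂(Measure.pi fun _ => μ) :=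
          lintegral_mono fun v => mul_le_mul_left (hK 0 _) _
      _ = K * ∫⁻ v : Fin (n + 1) → α, F v ∂(Measure.pi fun _ => μ) := lintegral_const_mul _ hF
      _ ≤ K * (K ^ n * ∫⁻ x, w x ∂μ) :=
          mul_le_mul_right (ih (fun i => h i.succ) (fun i => hm _) (fun i => hK _)) _
      _ = K ^ (n + 1) * ∫⁻ x, w x ∂μ := by rw [pow_succ', mul_assoc]

/-- A locally integrable kernel dominating `|t| ^ p` for all `p ∈ [-2/3, 0)`. -/
noncomputable def singularKernel (t : ℝ) : ENNReal :=
  1 + (Icc (-1 : ℝ) 1).indicator (fun t => ENNReal.ofReal (|t| ^ (-(2 / 3) : ℝ))) t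

lemma measurable_singularKernel : Measurable singularKernel := by
  have hpow : Measurable fun t : ℝ => ENNReal.ofReal (|t| ^ (-(2 / 3) : ℝ)) := by fun_prop
  exact measurable_const.add (hpow.indicator measurableSet_Icc)

lemma ofReal_abs_rpow_le_singularKernel {p : ℝ} (hp : -(2 / 3) ≤ p) (hp0 : p < 0) (t : ℝ) :
    ENNReal.ofReal (|t| ^ p) ≤ singularKernel t := by
  unfold singularKernel
  rcases le_total |t| 1 with ht | ht
  · rw [indicator_of_mem (mem_Icc.mpr (abs_le.mp ht))]
    refine le_add_left (ENNReal.ofReal_le_ofReal ?_)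
    rcases (abs_nonneg t).eq_or_lt with h0 | h0
    · rw [← h0, Real.zero_rpow hp0.ne]
      exact Real.rpow_nonneg le_rfl _
    · exact Real.rpow_le_rpow_of_exponent_ge h0 ht hp
  · refine le_add_right ?_
    rw [ENNReal.ofReal_le_one]
    exact Real.rpow_le_one_of_one_le_of_nonpos ht hp0.le

lemma lintegral_indicator_abs_rpow_lt_top :
    ∫⁻ t, (Icc (-1 : ℝ) 1).indicator (fun t => ENNReal.ofReal (|t| ^ (-(2 / 3) : ℝ))) t < ⊤ := by
  have h01 : IntervalIntegrable (fun t : ℝ => |t| ^ (-(2 / 3) : ℝ)) volume 0 1 := by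
    refine (intervalIntegral.intervalIntegrable_rpow' (r := -(2 / 3)) (by norm_num)).congr ?_
    intro t ht
    rw [uIoc_of_le zero_le_one] at ht
    simp [abs_of_pos ht.1]
  have hneg : IntervalIntegrable (fun t : ℝ => |t| ^ (-(2 / 3) : ℝ)) volume (-1) 0 := by
    simpa using h01.comp_sub_left 0 |>.symm
  have hint := (intervalIntegrable_iff_integrableOn_Icc_of_le (by norm_num)).mp (hneg.trans h01)
  rw [lintegral_indicator measurableSet_Icc]
  exact hint.lintegral_lt_top

/-- The exponential weight on the positive half-line. -/
noncomputable def expWeight (lam x : ℝ) : ENNReal := ENNReal.ofReal (Real.exp (-lam * x))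

lemma measurable_expWeight (lam : ℝ) : Measurable (expWeight lam) := by
  unfold expWeight
  fun_prop

lemma lintegral_expWeight_lt_top {lam : ℝ} (hlam : 0 < lam) :
    ∫⁻ x in Ioi (0 : ℝ), expWeight lam x < ⊤ :=
  (integrableOn_exp_mul_Ioi (neg_lt_zero.mpr hlam) 0).lintegral_lt_top

lemma exists_lintegral_expWeight_mul_singularKernel_le {lam : ℝ} (hlam : 0 < lam) :
    ∃ K < (⊤ : ENNReal), ∀ y : ℝ,
      ∫⁻ x in Ioi (0 : ℝ), expWeight lam x * singularKernel (x - y) ≤ K := by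
  let g : ℝ → ENNReal :=
    (Icc (-1 : ℝ) 1).indicator fun t => ENNReal.ofReal (|t| ^ (-(2 / 3) : ℝ))
  refine ⟨(∫⁻ x in Ioi (0 : ℝ), expWeight lam x) + ∫⁻ t, g t,
    ENNReal.add_lt_top.mpr ⟨lintegral_expWeight_lt_top hlam,
      lintegral_indicator_abs_rpow_lt_top⟩, fun y => ?_⟩
  calc ∫⁻ x in Ioi (0 : ℝ), expWeight lam x * singularKernel (x - y)
      ≤ ∫⁻ x in Ioi (0 : ℝ), (expWeight lam x + g (x - y)) := by
        refine setLIntegral_mono' measurableSet_Ioi fun x hx => ?_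
        have hle : expWeight lam x ≤ 1 := by
          rw [expWeight, ENNReal.ofReal_le_one, Real.exp_le_one_iff]
          have := mul_pos hlam hx
          linarith
        rw [singularKernel, mul_add, mul_one]
        exact add_le_add le_rfl (mul_le_of_le_one_left' hle)
    _ = (∫⁻ x in Ioi (0 : ℝ), expWeight lam x) + ∫⁻ x in Ioi (0 : ℝ), g (x - y) :=
        lintegral_add_left (measurable_expWeight lam) _
    _ ≤ (∫⁻ x in Ioi (0 : ℝ), expWeight lam x) + ∫⁻ x, g (x - y) :=
        add_le_add le_rfl (setLIntegral_le_lintegral _ _)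
    _ = _ := by rw [lintegral_sub_right_eq_self g y]

/-- The exponentially weighted integral over the four-cycle with the edge `j` removed is finite. -/
lemma lintegral_cycle_erase_lt_top {lam : ℝ} (hlam : 0 < lam) (c : Fin 4 → ℝ) (j : Fin 4) :
    ∫⁻ u in Set.pi Set.univ (fun _ : Fin 4 => Ioi (0 : ℝ)),
      (∏ i, expWeight lam (u i)) *
        ∏ i : Fin 3, singularKernel (u (j.succAbove i) - u (j.succAbove i + 1)
          - c (j.succAbove i)) < ⊤ := by
  obtain ⟨K, hKtop, hK⟩ := exists_lintegral_expWeight_mul_singularKernel_le hlam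
  let μ : Measure ℝ := volume.restrict (Ioi 0)
  let h : Fin 3 → ℝ → ℝ → ENNReal := fun i x y =>
    expWeight lam x * singularKernel (x - y - c (i.castSucc + (j + 1)))
  have hm : ∀ i, Measurable (Function.uncurry (h i)) := fun i =>
    ((measurable_expWeight lam).comp measurable_fst).mul
      (measurable_singularKernel.comp ((measurable_fst.sub measurable_snd).sub_const _))
  have hb : ∀ i y, ∫⁻ x, h i x y ∂μ ≤ K := fun i y => by
    simpa only [h, sub_sub] using hK (y + c (i.castSucc + (j + 1)))
  have hpath := lintegral_path_le μ (expWeight lam) (measurable_expWeight lam) K 3 h hm hb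
  have hfin : K ^ 3 * ∫⁻ x, expWeight lam x ∂μ < ⊤ :=
    ENNReal.mul_lt_top (ENNReal.pow_lt_top hKtop) (lintegral_expWeight_lt_top hlam)
  refine lt_of_le_of_lt (le_of_eq ?_) (hpath.trans_lt hfin)
  have hmp := measurePreserving_piCongrLeft (fun _ : Fin 4 => μ) (Equiv.addRight (j + 1))
  rw [volume_pi, Measure.restrict_pi_pi, ← hmp.lintegral_comp_emb
    (MeasurableEquiv.measurableEmbedding _)]
  refine lintegral_congr fun u => ?_
  have hv : ∀ i, MeasurableEquiv.piCongrLeft (fun _ : Fin 4 => ℝ) (Equiv.addRight (j + 1)) u i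
      = u (i - (j + 1)) := fun i => by
    have := MeasurableEquiv.piCongrLeft_apply_apply (β := fun _ : Fin 4 => ℝ)
      (Equiv.addRight (j + 1)) u (i - (j + 1))
    simpa only [Equiv.coe_addRight, sub_add_cancel] using this
  simp only [hv, h]
  have h1 : (-1 : Fin 4) = 3 := rfl
  have h2 : (-2 : Fin 4) = 2 := rfl
  have h3 : (-3 : Fin 4) = 1 := rfl
  fin_cases j <;> simp [Fin.prod_univ_succ, Fin.succAbove, h1, h2, h3] <;> ring

/-- The cyclic product of powers is dominated by path products of the singular kernel. -/
lemma enorm_cycle_integrand_le (lam : ℝ) (c : Fin 4 → ℝ) {H : ℝ} (hH : 1 / 2 < H)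
    (hH1 : H < 1) (u : Fin 4 → ℝ) :
    ‖Real.exp (-lam * ∑ i, u i) * ∏ i, |u i - u (i + 1) - c i| ^ (H - 1)‖ₑ ≤
      ∑ j : Fin 4, (∏ i, expWeight lam (u i)) *
        ∏ i : Fin 3, singularKernel (u (j.succAbove i) - u (j.succAbove i + 1)
          - c (j.succAbove i)) := by
  let x : Fin 4 → ℝ := fun i => u i - u (i + 1) - c i
  have hx3 : ∀ i, |x i| ^ (H - 1) = (|x i| ^ ((H - 1) / 3)) ^ 3 := fun i => by
    rw [← Real.rpow_mul_natCast (abs_nonneg _)]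
    congr 1
    push_cast
    ring
  have hx4 : ∀ i, (|x i| ^ ((H - 1) / 3)) ^ 4 = |x i| ^ (4 * (H - 1) / 3) := fun i => by
    rw [← Real.rpow_mul_natCast (abs_nonneg _)]
    congr 1
    push_cast
    ring
  have hprod := prod_pow_three_le_sum_prod_succAbove_pow_four (fun i => |x i| ^ ((H - 1) / 3))
    fun i => Real.rpow_nonneg (abs_nonneg _) _
  simp only [← hx3, hx4] at hprod
  have hnn : 0 ≤ ∏ i, |x i| ^ (H - 1) :=
    Finset.prod_nonneg fun i _ => Real.rpow_nonneg (abs_nonneg _) _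
  rw [Real.enorm_eq_ofReal (mul_nonneg (Real.exp_nonneg _) hnn),
    ENNReal.ofReal_mul (Real.exp_nonneg _), ← Finset.mul_sum]
  refine mul_le_mul' (le_of_eq ?_) ((ENNReal.ofReal_le_ofReal hprod).trans ?_)
  · simp only [expWeight]
    rw [← ENNReal.ofReal_prod_of_nonneg fun i _ => Real.exp_nonneg _, ← Real.exp_sum,
      Finset.mul_sum]
  · rw [ENNReal.ofReal_sum_of_nonneg fun j _ =>
      Finset.prod_nonneg fun i _ => Real.rpow_nonneg (abs_nonneg _) _]
    refine Finset.sum_le_sum fun j _ => ?_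
    rw [ENNReal.ofReal_prod_of_nonneg fun i _ => Real.rpow_nonneg (abs_nonneg _) _]
    exact Finset.prod_le_prod' fun i _ =>
      ofReal_abs_rpow_le_singularKernel (by linarith) (by linarith) _

/-- The four-cycle integral is bounded uniformly in `H ∈ (1/2, 1)`. -/
lemma exists_norm_cycle_integral_le {lam : ℝ} (hlam : 0 < lam) (c : Fin 4 → ℝ) :
    ∃ C : ℝ, ∀ H : ℝ, 1 / 2 < H → H < 1 →
      ‖∫ u in Set.pi Set.univ (fun _ : Fin 4 => Ioi (0 : ℝ)),
        Real.exp (-lam * ∑ i, u i) * ∏ i, |u i - u (i + 1) - c i| ^ (H - 1)‖ ≤ C := by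
  let B : Fin 4 → (Fin 4 → ℝ) → ENNReal := fun j u => (∏ i, expWeight lam (u i)) *
    ∏ i : Fin 3, singularKernel (u (j.succAbove i) - u (j.succAbove i + 1) - c (j.succAbove i))
  have hBm : ∀ j, Measurable (B j) := fun j => by
    refine (Finset.measurable_prod _ fun i _ =>
      (measurable_expWeight lam).comp (measurable_pi_apply i)).mul
      (Finset.measurable_prod _ fun i _ => measurable_singularKernel.comp ?_)
    fun_prop
  have hfin : ∫⁻ u in Set.pi Set.univ (fun _ : Fin 4 => Ioi (0 : ℝ)), ∑ j, B j u ≠ ⊤ := by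
    rw [lintegral_finsetSum _ fun j _ => hBm j]
    exact (ENNReal.sum_lt_top.mpr fun j _ => lintegral_cycle_erase_lt_top hlam c j).ne
  refine ⟨(∫⁻ u in Set.pi Set.univ (fun _ : Fin 4 => Ioi (0 : ℝ)), ∑ j, B j u).toReal,
    fun H hH hH1 => ?_⟩
  rw [← toReal_enorm]
  exact ENNReal.toReal_mono hfin ((enorm_integral_le_lintegral_enorm _).trans
    (lintegral_mono fun u => enorm_cycle_integrand_le lam c hH hH1 u))

/-- For `λ > 0` and `c₁ + c₂ + c₃ + c₄ = 0`, the quantity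
`(2H−1)² ∫_{(0,∞)⁴} e^{−λ(u₁+⋯+u₄)} ∏_{cyclic} |u_i − u_{i+1} − c_i|^{H−1} du` converges to
`0` as `H → 1/2` from the right. -/
theorem stationary_fourth_cumulant_tendsto_zero
    (lam : ℝ) (hlam : 0 < lam)
    (c : Fin 4 → ℝ) (hc : ∑ i : Fin 4, c i = 0) :
    Filter.Tendsto
      (fun H : ℝ =>
        (2 * H - 1) ^ 2 *
          ∫ u in Set.pi Set.univ (fun _ : Fin 4 => Set.Ioi (0 : ℝ)),
            Real.exp (-lam * ∑ i : Fin 4, u i) *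
              ∏ i : Fin 4, |u i - u (i + 1) - c i| ^ (H - 1))
      (nhdsWithin (1 / 2) (Set.Ioi (1 / 2 : ℝ)))
      (nhds 0) := by
  obtain ⟨C, hC⟩ := exists_norm_cycle_integral_le hlam c
  have hlim : Tendsto (fun H : ℝ => (2 * H - 1) ^ 2 * C) (nhdsWithin (1 / 2) (Ioi (1 / 2)))
      (nhds 0) := by
    have hcont : Continuous fun H : ℝ => (2 * H - 1) ^ 2 * C := by fun_prop
    have := (hcont.tendsto (1 / 2)).mono_left (nhdsWithin_le_nhds (s := Ioi (1 / 2)))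
    norm_num at this ⊢
    exact this
  refine squeeze_zero_norm' ?_ hlim
  filter_upwards [self_mem_nhdsWithin,
    nhdsWithin_le_nhds (Iio_mem_nhds (by norm_num : (1 / 2 : ℝ) < 1))] with H hH hH1
  rw [norm_mul, Real.norm_of_nonneg (sq_nonneg _)]
  exact mul_le_mul_of_nonneg_left (hC H hH hH1) (sq_nonneg _)
end
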